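/- arXiv:2511.20861 — 4 statements merged into one kernel-verified Lean document; each statement's English description precedes it below -/
import Mathlib

section
/- If P is a finite p-group of order p^n whose derived length is k+1, then n ≥ 2^k + 2k - 2. -/
/-- The derived length of a group: the least `n` with `derivedSeries G n = ⊥`. -/
noncomputable def derivedLength (G : Type*) [Group G] : ℕ :=
  sInf {n | derivedSeries G n = ⊥}

open scoped commutatorElement

/-- The iterated commutator subgroup `[N, G, …, G]` with `i` entries equal to `G`. -/
def iterComm {G : Type*} [Group G] (N : Subgroup G) : ℕ → Subgroup G
  | 0 => N
  | i + 1 => ⁅iterComm N i, (⊤ : Subgroup G)⁆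

section Commutators

variable {G : Type*} [Group G]

theorem iterComm_add (N : Subgroup G) (i j : ℕ) :
    iterComm (iterComm N i) j = iterComm N (i + j) := by
  induction j with
  | zero => rfl
  | succ j ih => rw [← add_assoc, iterComm, iterComm, ih]

instance iterComm_normal (N : Subgroup G) [N.Normal] (i : ℕ) : (iterComm N i).Normal := by
  induction i with
  | zero => assumption
  | succ i ih => rw [iterComm]; infer_instance

theorem iterComm_mono {N K : Subgroup G} (h : N ≤ K) (i : ℕ) : iterComm N i ≤ iterComm K i := by
  induction i with
  | zero => exact h
  | succ i ih => exact Subgroup.commutator_mono ih le_rfl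

/-- The three subgroups lemma modulo a normal subgroup. -/
theorem commutator_commutator_le_of_rotate {A B C K : Subgroup G} [K.Normal]
    (h1 : ⁅⁅B, C⁆, A⁆ ≤ K) (h2 : ⁅⁅C, A⁆, B⁆ ≤ K) : ⁅⁅A, B⁆, C⁆ ≤ K := by
  have key (H : Subgroup G) : H ≤ K ↔ H.map (QuotientGroup.mk' K) = ⊥ := by
    rw [Subgroup.map_eq_bot_iff, QuotientGroup.ker_mk']
  rw [key] at *
  simp only [Subgroup.map_commutator] at *
  exact Subgroup.commutator_commutator_eq_bot_of_rotate h1 h2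

theorem commutator_iterComm_top_le (N : Subgroup G) [N.Normal] (i : ℕ) :
    ⁅N, iterComm ⊤ i⁆ ≤ iterComm N (i + 1) := by
  induction i generalizing N with
  | zero => exact le_rfl
  | succ i ih =>
    rw [Subgroup.commutator_comm]
    refine commutator_commutator_le_of_rotate ?_ ?_
    · rw [Subgroup.commutator_comm ⊤ N]
      have h := ih (iterComm N 1)
      rwa [iterComm_add, add_comm 1] at h
    · exact Subgroup.commutator_mono (ih N) le_rfl

theorem commutator_closure_self_le {T : Set G} {D : Subgroup G} [D.Normal]
    (h : ∀ a ∈ T, ∀ b ∈ T, ⁅a, b⁆ ∈ D) : ⁅Subgroup.closure T, Subgroup.closure T⁆ ≤ D := by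
  rw [← QuotientGroup.ker_mk' D, ← Subgroup.map_eq_bot_iff, Subgroup.map_commutator,
    MonoidHom.map_closure, Subgroup.commutator_eq_bot_iff_le_centralizer,
    Subgroup.centralizer_closure, Subgroup.closure_le]
  rintro _ ⟨a, ha, rfl⟩
  rw [SetLike.mem_coe, Subgroup.mem_centralizer_iff]
  rintro _ ⟨b, hb, rfl⟩
  rw [← commutatorElement_eq_one_iff_mul_comm, ← map_commutatorElement]
  exact (QuotientGroup.eq_one_iff _).2 (h b hb a ha)

/-- If `N / [N, G]` is cyclic then `[N, N] ≤ [N, [N, G]]`. -/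
theorem commutator_self_le_of_closure_insert {N : Subgroup G} [N.Normal] {x : G}
    (hx : N = Subgroup.closure (insert x ((⁅N, (⊤ : Subgroup G)⁆ : Subgroup G) : Set G))) :
    ⁅N, N⁆ ≤ ⁅⁅N, (⊤ : Subgroup G)⁆, N⁆ := by
  have hT : insert x ((⁅N, (⊤ : Subgroup G)⁆ : Subgroup G) : Set G) ⊆ N := by
    conv_rhs => rw [hx]
    exact Subgroup.subset_closure
  have hle : ⁅Subgroup.closure (insert x ((⁅N, (⊤ : Subgroup G)⁆ : Subgroup G) : Set G)),
      Subgroup.closure (insert x ((⁅N, (⊤ : Subgroup G)⁆ : Subgroup G) : Set G))⁆ ≤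
      ⁅⁅N, (⊤ : Subgroup G)⁆, N⁆ := by
    refine commutator_closure_self_le fun a ha b hb => ?_
    have haN := hT ha
    rcases ha with rfl | ha'
    · rcases hb with rfl | hb'
      · rw [commutatorElement_self]; exact one_mem _
      · rw [Subgroup.commutator_comm]
        exact Subgroup.commutator_mem_commutator haN hb'
    · exact Subgroup.commutator_mem_commutator ha' (hT hb)
  rwa [← hx] at hle

theorem commutator_self_le_iterComm {N : Subgroup G} [N.Normal] {r : ℕ}
    (hr : N ≤ iterComm ⊤ r) : ⁅N, N⁆ ≤ iterComm N (r + 1) :=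
  (Subgroup.commutator_mono le_rfl hr).trans (commutator_iterComm_top_le N r)

theorem commutator_iterComm_one_le {N : Subgroup G} [N.Normal] {r : ℕ}
    (hr : N ≤ iterComm ⊤ r) : ⁅⁅N, (⊤ : Subgroup G)⁆, N⁆ ≤ iterComm N (r + 2) := by
  have h := (Subgroup.commutator_mono le_rfl hr).trans
    (commutator_iterComm_top_le (iterComm N 1) r)
  rwa [iterComm_add, show 1 + (r + 1) = r + 2 by ring] at h

theorem iterComm_le_iterComm_top {N : Subgroup G} {r : ℕ} (hr : N ≤ iterComm ⊤ r) (i : ℕ) :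
    iterComm N i ≤ iterComm ⊤ (r + i) :=
  (iterComm_mono hr i).trans (iterComm_add _ _ _).le

/-- If `N / [N, G]` is generated by two elements and `[N, N]` is the first term `[N, G, …, G]`
allowed by `N ≤ γ_{r + 1}(G)`, then `[N, N] / [[N, N], G]` is cyclic. -/
theorem exists_commutator_eq_closure_insert {N : Subgroup G} [N.Normal] {r : ℕ}
    (hr : N ≤ iterComm ⊤ r) (heq : ⁅N, N⁆ = iterComm N (r + 1)) {x y : G}
    (hxy : N = Subgroup.closure
      (insert y (insert x ((⁅N, (⊤ : Subgroup G)⁆ : Subgroup G) : Set G)))) :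
    ∃ z, ⁅N, N⁆ = Subgroup.closure
      (insert z ((⁅⁅N, N⁆, (⊤ : Subgroup G)⁆ : Subgroup G) : Set G)) := by
  set T := insert y (insert x ((⁅N, (⊤ : Subgroup G)⁆ : Subgroup G) : Set G)) with hTdef
  have hT : T ⊆ N := by
    rw [hxy]
    exact Subgroup.subset_closure
  have hxN : x ∈ N := hT (by simp [hTdef])
  have hyN : y ∈ N := hT (by simp [hTdef])
  set D := Subgroup.closure
    (insert ⁅x, y⁆ ((⁅⁅N, N⁆, (⊤ : Subgroup G)⁆ : Subgroup G) : Set G)) with hD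
  have hDN : D ≤ ⁅N, N⁆ := by
    rw [hD, Subgroup.closure_le, Set.insert_subset_iff]
    exact ⟨Subgroup.commutator_mem_commutator hxN hyN, Subgroup.commutator_le_left _ _⟩
  have hKD : ⁅⁅N, N⁆, (⊤ : Subgroup G)⁆ ≤ D :=
    (Set.subset_insert _ _).trans Subgroup.subset_closure
  have hDn : D.Normal := Subgroup.commutator_top_right_le_iff.1
    ((Subgroup.commutator_mono hDN le_rfl).trans hKD)
  have hND : ⁅⁅N, (⊤ : Subgroup G)⁆, N⁆ ≤ D := by
    refine (commutator_iterComm_one_le hr).trans (le_trans ?_ hKD)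
    rw [heq]
    exact le_rfl
  have hxyD : ⁅x, y⁆ ∈ D := Subgroup.subset_closure (Set.mem_insert _ _)
  have hleft : ∀ a ∈ ((⁅N, (⊤ : Subgroup G)⁆ : Subgroup G) : Set G), ∀ b ∈ N, ⁅a, b⁆ ∈ D :=
    fun a ha b hb =>
      hND (Subgroup.commutator_mem_commutator ha hb)
  have hright : ∀ a ∈ ((⁅N, (⊤ : Subgroup G)⁆ : Subgroup G) : Set G), ∀ b ∈ N, ⁅b, a⁆ ∈ D := by
    intro a ha b hb
    rw [← commutatorElement_inv]
    exact inv_mem (hleft a ha b hb)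
  refine ⟨⁅x, y⁆, le_antisymm ?_ hDN⟩
  have hle : ⁅Subgroup.closure T, Subgroup.closure T⁆ ≤ D := by
    refine commutator_closure_self_le fun a ha b hb => ?_
    have haN := hT ha
    have hbN := hT hb
    rcases ha with rfl | rfl | ha
    · rcases hb with rfl | rfl | hb
      · simp
      · rw [← commutatorElement_inv]
        exact inv_mem hxyD
      · exact hright b hb _ haN
    · rcases hb with rfl | rfl | hb
      · exact hxyD
      · simp
      · exact hright b hb _ haN
    · exact hleft a ha b hbN
  rwa [← hxy] at hle

theorem commutator_top_lt [Group.IsNilpotent G] {N : Subgroup G} [N.Normal] (hN : N ≠ ⊥) :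
    ⁅N, (⊤ : Subgroup G)⁆ < N := by
  refine lt_of_le_of_ne (Subgroup.commutator_le_left _ _) fun h => hN ?_
  obtain ⟨c, hc⟩ := Subgroup.nilpotent_iff_lowerCentralSeries.1 ‹Group.IsNilpotent G›
  have hle (i : ℕ) : N ≤ (⊤ : Subgroup G).lowerCentralSeries i := by
    induction i with
    | zero => exact le_top
    | succ i ih =>
      rw [← h]
      exact Subgroup.commutator_mono ih le_rfl
  exact le_bot_iff.1 (hc ▸ hle c)

end Commutators

section Length

variable {G : Type*} [Group G] {len : Subgroup G → ℕ}

theorem len_iterComm_add_le [Group.IsNilpotent G]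
    (hlen : StrictMono len) (N : Subgroup G) [N.Normal] {i : ℕ}
    (hi : iterComm N i ≠ ⊥) : len (iterComm N i) + i ≤ len N := by
  induction i with
  | zero => exact le_rfl
  | succ i ih =>
    have hne : iterComm N i ≠ ⊥ := fun h => hi (by rw [iterComm, h, Subgroup.commutator_bot_left])
    have h1 := ih hne
    have h2 : len (iterComm N (i + 1)) < len (iterComm N i) := hlen (commutator_top_lt hne)
    omega

theorem exists_lt_closure_insert {H N : Subgroup G} (h : H < N) :
    ∃ x, H < Subgroup.closure (insert x (H : Set G)) ∧
      Subgroup.closure (insert x (H : Set G)) ≤ N := by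
  obtain ⟨hle, x, hxN, hxH⟩ := SetLike.lt_iff_le_and_exists.1 h
  refine ⟨x, SetLike.lt_iff_le_and_exists.2 ⟨?_, x, ?_, hxH⟩, ?_⟩
  · exact (Set.subset_insert _ _).trans Subgroup.subset_closure
  · exact Subgroup.subset_closure (Set.mem_insert _ _)
  · rw [Subgroup.closure_le, Set.insert_subset_iff]
    exact ⟨hxN, hle⟩

/-- If `N / [N, G]` is cyclic then `N / [N, N]` is longer than `N ≤ γ_{r + 1}(G)` forces. -/
theorem len_commutator_add_le_of_closure_insert [Group.IsNilpotent G]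
    (hlen : StrictMono len) {N : Subgroup G} [N.Normal]
    {r : ℕ} (hr : N ≤ iterComm ⊤ r) (hN : ⁅N, N⁆ ≠ ⊥) {x : G}
    (hx : N = Subgroup.closure (insert x ((⁅N, (⊤ : Subgroup G)⁆ : Subgroup G) : Set G))) :
    len ⁅N, N⁆ + (r + 2) ≤ len N := by
  have hle := (commutator_self_le_of_closure_insert hx).trans (commutator_iterComm_one_le hr)
  have h1 := len_iterComm_add_le hlen N (ne_bot_of_le_ne_bot hN hle)
  have h2 := hlen.monotone hle
  omega

theorem len_iterComm_add_le_commutator_top [Group.IsNilpotent G]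
    (hlen : StrictMono len) {N : Subgroup G} [N.Normal]
    {r : ℕ} (hr : N ≤ iterComm ⊤ r) (hN : ⁅N, N⁆ ≠ ⊥) :
    len (iterComm N (r + 1)) + r ≤ len ⁅N, (⊤ : Subgroup G)⁆ := by
  have hne := ne_bot_of_le_ne_bot hN (commutator_self_le_iterComm hr)
  rw [add_comm r, ← iterComm_add] at hne ⊢
  exact len_iterComm_add_le hlen (iterComm N 1) hne

/-- P. Hall's bound. -/
theorem len_commutator_add_le [Group.IsNilpotent G]
    (hlen : StrictMono len) {N : Subgroup G} [N.Normal]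
    {r : ℕ} (hr : N ≤ iterComm ⊤ r) (hN : ⁅N, N⁆ ≠ ⊥) : len ⁅N, N⁆ + (r + 2) ≤ len N := by
  have hN' : N ≠ ⊥ := ne_bot_of_le_ne_bot hN (Subgroup.commutator_le_left _ _)
  obtain ⟨x, hx, hxN⟩ := exists_lt_closure_insert (commutator_top_lt hN')
  rcases hxN.eq_or_lt with h | h
  · exact len_commutator_add_le_of_closure_insert hlen hr hN h.symm
  · have h1 := len_iterComm_add_le_commutator_top hlen hr hN
    have h2 := hlen.monotone (commutator_self_le_iterComm hr)
    have h3 := hlen hx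
    have h4 := hlen h
    omega

/-- If Hall's bound is attained at `N`, then `N / [N, G]` or `[N, N] / [[N, N], G]` is cyclic. -/
theorem len_commutator_add_le_or_closure_insert [Group.IsNilpotent G]
    (hlen : StrictMono len) {N : Subgroup G}
    [N.Normal] {r : ℕ} (hr : N ≤ iterComm ⊤ r) (hN : ⁅N, N⁆ ≠ ⊥) :
    len ⁅N, N⁆ + (r + 3) ≤ len N ∨
    (∃ x, N = Subgroup.closure (insert x ((⁅N, (⊤ : Subgroup G)⁆ : Subgroup G) : Set G))) ∨
    ∃ z, ⁅N, N⁆ = Subgroup.closure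
      (insert z ((⁅⁅N, N⁆, (⊤ : Subgroup G)⁆ : Subgroup G) : Set G)) := by
  have hN' : N ≠ ⊥ := ne_bot_of_le_ne_bot hN (Subgroup.commutator_le_left _ _)
  have h1 := len_iterComm_add_le_commutator_top hlen hr hN
  have hle := commutator_self_le_iterComm hr
  obtain ⟨x, hx, hxN⟩ := exists_lt_closure_insert (commutator_top_lt hN')
  have hx' := hlen hx
  rcases hxN.eq_or_lt with h | h
  · exact Or.inr (Or.inl ⟨x, h.symm⟩)
  obtain ⟨y, hy, hyN⟩ := exists_lt_closure_insert h
  have hy' := hlen hy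
  rcases hyN.eq_or_lt with h' | h'
  · rcases hle.eq_or_lt with heq | hlt
    · refine Or.inr (Or.inr (exists_commutator_eq_closure_insert hr heq (x := x) (y := y) ?_))
      refine le_antisymm ?_ ?_
      · conv_lhs => rw [← h']
        rw [Subgroup.closure_le, Set.insert_subset_iff]
        exact ⟨Subgroup.subset_closure (Set.mem_insert _ _),
          Subgroup.closure_mono (Set.subset_insert _ _)⟩
      · conv_rhs => rw [← h']
        exact Subgroup.closure_mono (Set.insert_subset_insert Subgroup.subset_closure)
    · have h2 := hlen hlt
      have h3 := hlen.monotone hyN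
      omega
  · have h2 := hlen.monotone hle
    have h3 := hlen h'
    omega

end Length

section DerivedSeries

variable {G : Type*} [Group G]

theorem derivedSeries_le_iterComm (d : ℕ) : derivedSeries G d ≤ iterComm ⊤ (2 ^ d - 1) := by
  induction d with
  | zero => exact le_top
  | succ d ih =>
    have := derivedSeries_normal G d
    have hpos : 0 < 2 ^ d := by positivity
    have h := (commutator_self_le_iterComm ih).trans (iterComm_le_iterComm_top ih _)
    rwa [show 2 ^ d - 1 + (2 ^ d - 1 + 1) = 2 ^ (d + 1) - 1 by rw [pow_succ]; omega] at h

theorem derivedSeries_succ_le_of_closure_insert {d : ℕ} {x : G}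
    (hx : derivedSeries G d =
      Subgroup.closure (insert x ((⁅derivedSeries G d, (⊤ : Subgroup G)⁆ : Subgroup G) : Set G))) :
    derivedSeries G (d + 1) ≤ iterComm ⊤ (2 ^ (d + 1)) := by
  have := derivedSeries_normal G d
  have hpos : 0 < 2 ^ d := by positivity
  have hr := derivedSeries_le_iterComm (G := G) d
  have h := ((commutator_self_le_of_closure_insert hx).trans
    (commutator_iterComm_one_le hr)).trans (iterComm_le_iterComm_top hr _)
  rwa [show 2 ^ d - 1 + (2 ^ d - 1 + 2) = 2 ^ (d + 1) by rw [pow_succ]; omega] at h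

theorem derivedSeries_succ_le_of_le {d : ℕ} (hd : derivedSeries G d ≤ iterComm ⊤ (2 ^ d)) :
    derivedSeries G (d + 1) ≤ iterComm ⊤ (2 ^ (d + 1)) := by
  have := derivedSeries_normal G d
  have h := (commutator_self_le_iterComm hd).trans (iterComm_le_iterComm_top hd _)
  refine h.trans ?_
  rw [show 2 ^ d + (2 ^ d + 1) = 2 ^ (d + 1) + 1 by rw [pow_succ]; omega]
  exact Subgroup.commutator_le_left _ _

/-- Along the derived series Hall's bound is attained at most twice: the second disjunct describes
the situation right after the first time, the third one all later terms. -/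
theorem len_derivedSeries_add_le [Group.IsNilpotent G] {len : Subgroup G → ℕ}
    (hlen : StrictMono len) {d : ℕ} (hd : derivedSeries G d ≠ ⊥) :
    len (derivedSeries G d) + 2 ^ d + 2 * d ≤ len ⊤ + 1 ∨
    (len (derivedSeries G d) + 2 ^ d + 2 * d ≤ len ⊤ + 2 ∧ ∃ x, derivedSeries G d =
      Subgroup.closure (insert x ((⁅derivedSeries G d, (⊤ : Subgroup G)⁆ : Subgroup G) : Set G))) ∨
    (len (derivedSeries G d) + 2 ^ d + 2 * d ≤ len ⊤ + 3 ∧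
      derivedSeries G d ≤ iterComm ⊤ (2 ^ d)) := by
  induction d with
  | zero => exact Or.inl (by simp)
  | succ d ih =>
    have := derivedSeries_normal G d
    have hpos : 0 < 2 ^ d := by positivity
    have hr := derivedSeries_le_iterComm (G := G) d
    have hpow : 2 ^ (d + 1) = 2 ^ d + 2 ^ d := by rw [pow_succ]; omega
    have hall : len (derivedSeries G (d + 1)) + (2 ^ d - 1 + 2) ≤ len (derivedSeries G d) :=
      len_commutator_add_le hlen hr hd
    have hne : derivedSeries G d ≠ ⊥ :=
      ne_bot_of_le_ne_bot hd (Subgroup.commutator_le_left _ _)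
    rcases ih hne with h | ⟨h, x, hx⟩ | ⟨h, hle⟩
    · rcases len_commutator_add_le_or_closure_insert hlen hr hd with h' | ⟨x, hx⟩ | hz
      · left
        rw [← derivedSeries_succ] at h'
        omega
      · exact Or.inr (Or.inr ⟨by omega, derivedSeries_succ_le_of_closure_insert hx⟩)
      · exact Or.inr (Or.inl ⟨by omega, hz⟩)
    · exact Or.inr (Or.inr ⟨by omega, derivedSeries_succ_le_of_closure_insert hx⟩)
    · have h' : len (derivedSeries G (d + 1)) + (2 ^ d + 2) ≤ len (derivedSeries G d) :=
        len_commutator_add_le hlen hle hd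
      exact Or.inr (Or.inr ⟨by omega, derivedSeries_succ_le_of_le hle⟩)

end DerivedSeries

theorem IsPGroup.exists_strictMono_card_eq_pow {G : Type*} [Group G] [Finite G] {p : ℕ}
    [hp : Fact p.Prime] (hG : IsPGroup p G) :
    ∃ len : Subgroup G → ℕ, StrictMono len ∧ ∀ H : Subgroup G, Nat.card H = p ^ len H := by
  choose len hcard using fun H : Subgroup G => IsPGroup.iff_card.1 (hG.to_subgroup H)
  refine ⟨len, fun H K h => ?_, hcard⟩
  rw [← Nat.pow_lt_pow_iff_right hp.out.one_lt, ← hcard, ← hcard]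
  exact Set.Finite.card_lt_card (Set.toFinite _) h

/-- If `P` is a finite `p`-group of order `p ^ n` whose derived length is `k + 1`,
then `n ≥ 2 ^ k + 2 * k - 2`. -/
theorem stmt0 {P : Type*} [Group P] [Fintype P] {p n k : ℕ} (hp : p.Prime)
    (hcard : Fintype.card P = p ^ n) (hdl : derivedLength P = k + 1) :
    2 ^ k + 2 * k ≤ n + 2 := by
  have := Fact.mk hp
  rw [← Nat.card_eq_fintype_card] at hcard
  have hP : IsPGroup p P := IsPGroup.of_card hcard
  have := hP.isNilpotent
  obtain ⟨len, hlen, hlencard⟩ := hP.exists_strictMono_card_eq_pow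
  have htop : len ⊤ = n := by
    have h := hlencard ⊤
    rw [Subgroup.card_top, hcard] at h
    exact (Nat.pow_right_injective hp.two_le h).symm
  have hk : derivedSeries P k ≠ ⊥ :=
    Nat.notMem_of_lt_sInf (s := {n | derivedSeries P n = ⊥}) (k.lt_succ_self.trans_eq hdl.symm)
  have hpos := hlen (bot_lt_iff_ne_bot.2 hk)
  rcases len_derivedSeries_add_le hlen hk with h | ⟨h, -⟩ | ⟨h, -⟩ <;> omega
end

section
/- Let G be a finite p-solvable group and P a Sylow p-subgroup of G. Then the derived length of P is at most one more than the number of irreducible complex characters of G whose degree is divisible by p; that is, dl(P) ≤ n_p(G) + 1. -/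
/-- A group is `p`-solvable if every composition factor (simple quotient of a subquotient)
is either a `p`-group or has order prime to `p`. -/
def IsPSolvable (p : ℕ) (G : Type*) [Group G] : Prop :=
  ∀ (H : Subgroup G) (K : Subgroup H) [K.Normal],
    IsSimpleGroup (H ⧸ K) → IsPGroup p (H ⧸ K) ∨ ¬ p ∣ Nat.card (H ⧸ K)

/-- `n_p(G)`: the number of irreducible complex characters of `G` whose degree is
divisible by `p`. -/
noncomputable def npChar (p : ℕ) (G : Type) [Group G] [Fintype G] : ℕ :=
  Nat.card {χ : G → ℂ // ∃ V : FDRep ℂ G, CategoryTheory.Simple V ∧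
    (fun g => V.character g) = χ ∧ p ∣ Module.finrank ℂ V}

open Module

namespace Representation

section Basic

variable {G V : Type*} [Group G] [AddCommGroup V] [Module ℂ V] (ρ : Representation ℂ G V)

theorem isIrreducible_iff_forall_submodule : ρ.IsIrreducible ↔ Nontrivial V ∧
    ∀ W : Submodule ℂ V, (∀ g, ∀ v ∈ W, ρ g v ∈ W) → W = ⊥ ∨ W = ⊤ := by
  constructor
  · intro h
    refine ⟨?_, fun W hW => ?_⟩
    · by_contra hV
      rw [not_nontrivial_iff_subsingleton] at hV
      refine bot_ne_top (α := Subrepresentation ρ) (Subrepresentation.toSubmodule_injective ?_)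
      exact Subsingleton.elim _ _
    · rcases h.eq_bot_or_eq_top (⟨W, fun g v hv => hW g v hv⟩ : Subrepresentation ρ) with h | h
      · exact Or.inl (congrArg Subrepresentation.toSubmodule h)
      · exact Or.inr (congrArg Subrepresentation.toSubmodule h)
  · rintro ⟨hV, h⟩
    refine { exists_pair_ne := ⟨⊥, ⊤, fun e => ?_⟩, eq_bot_or_eq_top := fun U => ?_ }
    · exact bot_ne_top (α := Submodule ℂ V) (congrArg Subrepresentation.toSubmodule e)
    · rcases h U.toSubmodule (fun g v hv => U.apply_mem_toSubmodule g hv) with h | h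
      · exact Or.inl (Subrepresentation.toSubmodule_injective h)
      · exact Or.inr (Subrepresentation.toSubmodule_injective h)

variable {ρ} in
theorem IsIrreducible.eq_top (h : ρ.IsIrreducible) {W : Submodule ℂ V}
    (hW : ∀ g, ∀ v ∈ W, ρ g v ∈ W) (hne : W ≠ ⊥) : W = ⊤ :=
  (((isIrreducible_iff_forall_submodule ρ).1 h).2 W hW).resolve_left hne

/-- The restriction of a representation to an invariant subspace. -/
def subrep (W : Submodule ℂ V) (hW : ∀ g, ∀ v ∈ W, ρ g v ∈ W) : Representation ℂ G W where
  toFun g := (ρ g).restrict (hW g)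
  map_one' := by ext; simp
  map_mul' g h := by ext; simp

@[simp]
theorem coe_subrep_apply (W : Submodule ℂ V) (hW : ∀ g, ∀ v ∈ W, ρ g v ∈ W) (g : G) (v : W) :
    (ρ.subrep W hW g v : V) = ρ g v := rfl

theorem exists_isCompl_invariant [Finite G] (W : Submodule ℂ V)
    (hW : ∀ g, ∀ v ∈ W, ρ g v ∈ W) :
    ∃ W' : Submodule ℂ V, (∀ g, ∀ v ∈ W', ρ g v ∈ W') ∧ IsCompl W W' := by
  have : NeZero (Nat.card G : ℂ) := ⟨by simp [Nat.card_pos.ne']⟩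
  have : IsSemisimpleRepresentation ρ := inferInstance
  obtain ⟨U, hU⟩ := exists_isCompl (⟨W, fun g v hv => hW g v hv⟩ : Subrepresentation ρ)
  refine ⟨U.toSubmodule, fun g v hv => U.apply_mem_toSubmodule g hv, ?_, ?_⟩
  · rw [disjoint_iff]
    exact congrArg Subrepresentation.toSubmodule (disjoint_iff.1 hU.1)
  · rw [codisjoint_iff]
    exact congrArg Subrepresentation.toSubmodule (codisjoint_iff.1 hU.2)

theorem exists_isIrreducible_subrep [FiniteDimensional ℂ V] (W : Submodule ℂ V)
    (hW : ∀ g, ∀ v ∈ W, ρ g v ∈ W) (hne : W ≠ ⊥) :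
    ∃ (U : Submodule ℂ V) (hU : ∀ g, ∀ v ∈ U, ρ g v ∈ U), U ≤ W ∧
      (ρ.subrep U hU).IsIrreducible := by
  obtain ⟨U, ⟨hU, hUne, hUW⟩, hmin⟩ := WellFounded.has_min
    (wellFounded_lt (α := Submodule ℂ V))
    {U | (∀ g, ∀ v ∈ U, ρ g v ∈ U) ∧ U ≠ ⊥ ∧ U ≤ W} ⟨W, hW, hne, le_rfl⟩
  refine ⟨U, hU, hUW, ?_⟩
  rw [isIrreducible_iff_forall_submodule]
  refine ⟨Submodule.nontrivial_iff_ne_bot.2 hUne, fun X hX => ?_⟩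
  by_cases hX0 : X = ⊥
  · exact Or.inl hX0
  · right
    have h1 : X.map U.subtype ≤ U := Submodule.map_subtype_le U X
    have h2 : ¬ X.map U.subtype < U := by
      refine hmin _ ⟨?_, ?_, h1.trans hUW⟩
      · rintro g _ ⟨v, hv, rfl⟩
        exact ⟨ρ.subrep U hU g v, hX g v hv, rfl⟩
      · intro h
        exact hX0 (Submodule.map_injective_of_injective U.injective_subtype (by simpa using h))
    have h3 : X.map U.subtype = U := h1.eq_of_not_lt h2
    rw [eq_top_iff]
    intro v _
    have : (v : V) ∈ X.map U.subtype := h3.symm ▸ v.2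
    obtain ⟨u, hu, huv⟩ := this
    rwa [← Subtype.ext huv]

end Basic

end Representation

namespace Module.End

theorem exists_common_eigenvector {ι V : Type*} [AddCommGroup V] [Module ℂ V]
    [FiniteDimensional ℂ V] [Nontrivial V] (F : ι → End ℂ V) (hF : ∀ i j, Commute (F i) (F j)) :
    ∃ (w : ι → ℂ) (v : V), v ≠ 0 ∧ ∀ i, F i v = w i • v := by
  obtain ⟨U, ⟨hU, hUne⟩, hmin⟩ := WellFounded.has_min
    (wellFounded_lt (α := Submodule ℂ V))
    {U | (∀ i, ∀ v ∈ U, F i v ∈ U) ∧ U ≠ ⊥} ⟨⊤, by simp, top_ne_bot⟩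
  have hU' : Nontrivial U := Submodule.nontrivial_iff_ne_bot.2 hUne
  have key : ∀ i, ∃ μ : ℂ, ∀ v ∈ U, F i v = μ • v := by
    intro i
    obtain ⟨μ, hμ⟩ := Module.End.exists_eigenvalue ((F i).restrict (hU i))
    obtain ⟨u, hu⟩ := hμ.exists_hasEigenvector
    have huv : F i u = μ • (u : V) := congrArg Subtype.val hu.apply_eq_smul
    refine ⟨μ, ?_⟩
    have h1 : ¬ U ⊓ (F i).eigenspace μ < U := by
      refine hmin _ ⟨?_, ?_⟩
      · rintro j v ⟨hv, hv'⟩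
        refine ⟨hU j v hv, ?_⟩
        change F j v ∈ (F i).eigenspace μ
        have hv' : v ∈ (F i).eigenspace μ := hv'
        rw [Module.End.mem_eigenspace_iff] at hv' ⊢
        have := LinearMap.congr_fun (hF i j).eq v
        simp only [Module.End.mul_apply] at this
        rw [this, hv', map_smul]
      · intro h
        apply hu.2
        have : (u : V) ∈ U ⊓ (F i).eigenspace μ :=
          ⟨u.2, Module.End.mem_eigenspace_iff.2 huv⟩
        rw [h, Submodule.mem_bot] at this
        exact Subtype.ext this
    have h2 := inf_le_left.eq_of_not_lt h1
    intro v hv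
    rw [← h2] at hv
    exact Module.End.mem_eigenspace_iff.1 hv.2
  choose w hw using key
  obtain ⟨v, hv⟩ := exists_ne (0 : U)
  exact ⟨w, v, fun h => hv (Subtype.ext h), fun i => hw i v v.2⟩

end Module.End

namespace Representation

/-- A linear combination of group elements that vanishes in every irreducible representation
is trivial. -/
theorem eq_zero_of_forall_isIrreducible {G : Type} [Group G] [Fintype G] (a : G → ℂ)
    (ha : ∀ (V : Type) [AddCommGroup V] [Module ℂ V] [FiniteDimensional ℂ V]
      (ρ : Representation ℂ G V), ρ.IsIrreducible → ∀ v, ∑ g, a g • ρ g v = 0) : a = 0 := by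
  let ρ : Representation ℂ G (G → ℂ) :=
    { toFun := fun g => LinearMap.funLeft ℂ ℂ (fun x => g⁻¹ * x)
      map_one' := by ext; simp [LinearMap.funLeft]
      map_mul' := fun g h => by ext; simp [LinearMap.funLeft, mul_assoc] }
  have hρ : ∀ g f x, ρ g f x = f (g⁻¹ * x) := fun g f x => rfl
  let A : End ℂ (G → ℂ) := ∑ g, a g • ρ g
  have hA : ∀ v, A v = ∑ g, a g • ρ g v := fun v => by simp [A]
  let K : Submodule ℂ (G → ℂ) := ⨅ h, (LinearMap.ker A).comap (ρ h)
  have hK : ∀ v, v ∈ K ↔ ∀ h, A (ρ h v) = 0 := fun v => by simp [K]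
  have hKinv : ∀ g, ∀ v ∈ K, ρ g v ∈ K := by
    intro g v hv
    rw [hK] at hv ⊢
    intro h
    simpa only [map_mul, Module.End.mul_apply] using hv (h * g)
  obtain ⟨K', hK', hc⟩ := ρ.exists_isCompl_invariant K hKinv
  have hbot : K' = ⊥ := by
    by_contra hne
    obtain ⟨U, hU, hUK, hirr⟩ := ρ.exists_isIrreducible_subrep K' hK' hne
    have : U ≤ K := by
      intro v hv
      rw [hK]
      intro h
      rw [hA]
      have := congrArg Subtype.val (ha U (ρ.subrep U hU) hirr ⟨ρ h v, hU h v hv⟩)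
      simpa using this
    have hU0 : U = ⊥ := le_bot_iff.1 (hc.disjoint this hUK)
    have := ((isIrreducible_iff_forall_submodule _).1 hirr).1
    exact (Submodule.nontrivial_iff_ne_bot.1 this) hU0
  have htop : K = ⊤ := by
    have := hc.sup_eq_top
    rwa [hbot, sup_bot_eq] at this
  classical
  have h1 : A (Pi.single 1 1) = 0 := by
    have : (Pi.single 1 1 : G → ℂ) ∈ K := htop ▸ Submodule.mem_top
    simpa using (hK _).1 this 1
  funext x
  have h2 := congrFun h1 x
  rw [hA, Finset.sum_apply] at h2
  simp only [Pi.smul_apply, hρ, smul_eq_mul, Pi.zero_apply] at h2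
  rw [Finset.sum_eq_single x] at h2
  · simpa using h2
  · intro b _ hb
    rw [Pi.single_eq_of_ne, mul_zero]
    rwa [Ne, inv_mul_eq_one]
  · simp

/-- Clifford's theorem for weight spaces: if a commuting family of operators is permuted by the
group, then a nonzero space of vectors of a fixed weight which is invariant under the stabilizer
`T` of that weight has dimension `dim V / |G : T|`. -/
theorem IsIrreducible.finrank_eq_index_mul {G V ι : Type*} [Group G] [Finite G] [AddCommGroup V]
    [Module ℂ V] [FiniteDimensional ℂ V] {ρ : Representation ℂ G V} (hρ : ρ.IsIrreducible)
    [MulAction G ι] (F : ι → End ℂ V) (hcomm : ∀ i j, Commute (F i) (F j))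
    (hF : ∀ g i v, F (g • i) (ρ g v) = ρ g (F i v)) (w : ι → ℂ) (X : Submodule ℂ V) (hX : X ≠ ⊥)
    (hXw : ∀ i, ∀ v ∈ X, F i v = w i • v) (T : Subgroup G)
    (hT : ∀ g, g ∈ T ↔ ∀ i, w (g • i) = w i) (hXT : ∀ g ∈ T, ∀ v ∈ X, ρ g v ∈ X) :
    finrank ℂ V = T.index * finrank ℂ X := by
  classical
  have hinj : ∀ g, Function.Injective (ρ g) := fun g =>
    Function.LeftInverse.injective (g := ρ g⁻¹) fun v => by simp
  let Y : G ⧸ T → Submodule ℂ V := fun q => X.map (ρ q.out)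
  have hY : ∀ g : G, Y g = X.map (ρ g) := by
    intro g
    obtain ⟨t, ht⟩ := QuotientGroup.mk_out_eq_mul T g
    have hmap : X.map (ρ t) = X := by
      refine Submodule.eq_of_le_of_finrank_eq ?_
        (LinearEquiv.finrank_eq (Submodule.equivMapOfInjective _ (hinj _) X).symm)
      rintro _ ⟨v, hv, rfl⟩
      exact hXT t t.2 v hv
    simp only [Y, ht, map_mul]
    rw [Module.End.mul_eq_comp, Submodule.map_comp, hmap]
  have hfin : ∀ q, finrank ℂ (Y q) = finrank ℂ X := fun q =>
    LinearEquiv.finrank_eq (Submodule.equivMapOfInjective _ (hinj _) X).symm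
  have hw : ∀ (g : G) i, ∀ v ∈ X.map (ρ g), F i v = w (g⁻¹ • i) • v := by
    rintro g i _ ⟨v, hv, rfl⟩
    have := hF g (g⁻¹ • i) v
    rw [smul_inv_smul, hXw _ v hv, map_smul] at this
    exact this
  have hind : iSupIndep Y := by
    have h0 := Module.End.independent_iInf_maxGenEigenspace_of_forall_mapsTo F
      (fun i j φ => Module.End.mapsTo_maxGenEigenspace_of_comm (hcomm j i) φ)
    have hinjw : Function.Injective (fun (q : G ⧸ T) (i : ι) => w (q.out⁻¹ • i)) := by
      intro q r h
      rw [← q.out_eq, ← r.out_eq]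
      refine QuotientGroup.eq.2 ((hT _).2 fun i => ?_)
      have := congrFun h (r.out • i)
      simp only [inv_smul_smul] at this
      rw [mul_smul, this]
    refine (h0.comp hinjw).mono fun q v hv => ?_
    simp only [Function.comp_apply, Submodule.mem_iInf]
    intro i
    refine Module.End.mem_maxGenEigenspace _ _ _ |>.2 ⟨1, ?_⟩
    simp [hw _ i v hv]
  have hsup : ⨆ q, Y q = ⊤ := by
    refine hρ.eq_top (fun g v hv => ?_) ?_
    · suffices (⨆ q, Y q) ≤ (⨆ q, Y q).comap (ρ g) from this hv
      refine iSup_le fun q => ?_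
      obtain ⟨h, rfl⟩ := QuotientGroup.mk_surjective q
      rw [hY h]
      rintro _ ⟨v, hv, rfl⟩
      refine Submodule.mem_iSup_of_mem ((g * h : G) : G ⧸ T) ?_
      rw [hY]
      exact ⟨v, hv, by simp⟩
    · intro h0
      have : Y ((1 : G) : G ⧸ T) ≤ ⊥ := h0 ▸ le_iSup Y _
      rw [hY, map_one] at this
      exact hX (le_bot_iff.1 (by simpa [Module.End.one_eq_id] using this))
  have := Fintype.ofFinite (G ⧸ T)
  have hint := DirectSum.isInternal_submodule_of_iSupIndep_of_iSup_eq_top hind hsup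
  rw [← (LinearEquiv.ofBijective (DirectSum.coeLinearMap Y) hint).finrank_eq,
    Module.finrank_directSum]
  simp [hfin, Subgroup.index, Nat.card_eq_fintype_card]

end Representation
/-- Every irreducible complex representation of `G` has degree prime to `p`. -/
def DegreesPrimeTo (p : ℕ) (G : Type) [Group G] : Prop :=
  ∀ (V : Type) [AddCommGroup V] [Module ℂ V] [FiniteDimensional ℂ V] (ρ : Representation ℂ G V),
    ρ.IsIrreducible → ¬ p ∣ finrank ℂ V

namespace Representation

theorem eq_of_forall_isIrreducible {G : Type} [Group G] [Finite G] (x y : G)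
    (h : ∀ (V : Type) [AddCommGroup V] [Module ℂ V] [FiniteDimensional ℂ V]
      (ρ : Representation ℂ G V), ρ.IsIrreducible → ∀ v, ρ x v = ρ y v) : x = y := by
  classical
  have := Fintype.ofFinite G
  by_contra hxy
  have h0 := eq_zero_of_forall_isIrreducible (Pi.single x 1 - Pi.single y 1 : G → ℂ)
    (fun V _ _ _ ρ hρ v => by
      simp only [Pi.sub_apply, sub_smul, Finset.sum_sub_distrib, Pi.single_apply, ite_smul,
        one_smul, zero_smul, Finset.sum_ite_eq', Finset.mem_univ, if_true, sub_eq_zero]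
      exact h V ρ hρ v)
  have := congrFun h0 x
  simp [hxy] at this

/-- A commuting family of operators permuted by the group has a weight, and the index of the
stabilizer of this weight divides the degree. -/
theorem IsIrreducible.exists_weight {G V ι : Type*} [Group G] [Finite G] [AddCommGroup V]
    [Module ℂ V] [FiniteDimensional ℂ V] {ρ : Representation ℂ G V} (hρ : ρ.IsIrreducible)
    [MulAction G ι] (F : ι → End ℂ V) (hcomm : ∀ i j, Commute (F i) (F j))
    (hF : ∀ g i v, F (g • i) (ρ g v) = ρ g (F i v)) :
    ∃ (w : ι → ℂ) (X : Submodule ℂ V) (T : Subgroup G), X ≠ ⊥ ∧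
      (∀ i, ∀ v ∈ X, F i v = w i • v) ∧ (∀ g, g ∈ T ↔ ∀ i, w (g • i) = w i) ∧
      (∀ g ∈ T, ∀ v ∈ X, ρ g v ∈ X) ∧ finrank ℂ V = T.index * finrank ℂ X := by
  have := ((isIrreducible_iff_forall_submodule ρ).1 hρ).1
  obtain ⟨w, v, hv0, hv⟩ := Module.End.exists_common_eigenvector F hcomm
  let X : Submodule ℂ V := ⨅ i, (F i).eigenspace (w i)
  have hX : ∀ v, v ∈ X ↔ ∀ i, F i v = w i • v := fun v => by
    simp [X, Submodule.mem_iInf]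
  let T : Subgroup G :=
    { carrier := {g | ∀ i, w (g • i) = w i}
      one_mem' := fun i => by simp
      mul_mem' := fun {a b} ha hb i => by rw [mul_smul, ha, hb]
      inv_mem' := fun {a} ha i => by rw [← ha (a⁻¹ • i), smul_inv_smul] }
  have hXne : X ≠ ⊥ := fun h => hv0 (by
    have := (hX v).2 hv
    rwa [h, Submodule.mem_bot] at this)
  have hXT : ∀ g ∈ T, ∀ v ∈ X, ρ g v ∈ X := by
    intro g hg v hv
    rw [hX] at hv ⊢
    intro i
    have := hF g (g⁻¹ • i) v
    rw [smul_inv_smul, hv, map_smul, ← hg, smul_inv_smul] at this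
    exact this
  exact ⟨w, X, T, hXne, fun i v hv => (hX v).1 hv i, fun g => Iff.rfl, hXT,
    hρ.finrank_eq_index_mul F hcomm hF w X hXne (fun i v hv => (hX v).1 hv i) T
      (fun g => Iff.rfl) hXT⟩

theorem IsIrreducible.isScalar_of_isPGroup {P V : Type*} [Group P] [Finite P] [AddCommGroup V]
    [Module ℂ V] [FiniteDimensional ℂ V] {ρ : Representation ℂ P V} (hρ : ρ.IsIrreducible)
    {p : ℕ} [Fact p.Prime] (hP : IsPGroup p P) (hdim : ¬ p ∣ finrank ℂ V) (g : P) :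
    ∃ c : ℂ, ∀ v, ρ g v = c • v := by
  have hnt := ((isIrreducible_iff_forall_submodule ρ).1 hρ).1
  let S : Subgroup P :=
    { carrier := {g | ∃ c : ℂ, ∀ v, ρ g v = c • v}
      one_mem' := ⟨1, by simp⟩
      mul_mem' := by
        rintro a b ⟨c, hc⟩ ⟨d, hd⟩
        exact ⟨c * d, fun v => by rw [map_mul, Module.End.mul_apply, hd, map_smul, hc, smul_smul,
          mul_comm]⟩
      inv_mem' := by
        rintro a ⟨c, hc⟩
        have key : ∀ v, c • ρ a⁻¹ v = v := fun v => by rw [← hc]; simp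
        have hc0 : c ≠ 0 := by
          rintro rfl
          obtain ⟨v, hv⟩ := exists_ne (0 : V)
          exact hv (by simpa using (key v).symm)
        exact ⟨c⁻¹, fun v => by rw [eq_inv_smul_iff₀ hc0, key]⟩ }
  have hS : S.Normal := ⟨by
    rintro s ⟨c, hc⟩ g
    exact ⟨c, fun v => by simp [hc]⟩⟩
  suffices h : S = ⊤ by exact (h ▸ Subgroup.mem_top g : g ∈ S)
  by_contra hne
  have hntq : Nontrivial (P ⧸ S) := by
    rwa [QuotientGroup.nontrivial_iff]
  have hc := (hP.to_quotient S).center_nontrivial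
  obtain ⟨⟨z, hz⟩, hz1⟩ := exists_ne (1 : Subgroup.center (P ⧸ S))
  obtain ⟨a, rfl⟩ := QuotientGroup.mk_surjective z
  have haS : a ∉ S := fun h => hz1 (Subtype.ext ((QuotientGroup.eq_one_iff a).2 h))
  have hconj : ∀ g : P, ∃ c : ℂ, ∀ v, ρ (g * a * g⁻¹) v = c • ρ a v := by
    intro g
    have h1 : g * a * g⁻¹ * a⁻¹ ∈ S := by
      rw [← QuotientGroup.eq_one_iff]
      have := Subgroup.mem_center_iff.1 hz (g : P ⧸ S)
      simp only [QuotientGroup.mk_mul, QuotientGroup.mk_inv]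
      rw [this]; group
    obtain ⟨c, hc⟩ := h1
    exact ⟨c, fun v => by rw [← hc, ← Module.End.mul_apply, ← map_mul]; simp⟩
  choose c hc using hconj
  obtain ⟨w, X, T, hX, hXw, hT, -, hfin⟩ := hρ.exists_weight (ι := P)
    (fun g => ρ (g * a * g⁻¹)) (fun i j => by
      ext v
      simp [hc, -map_mul]
      rw [smul_smul, smul_smul, mul_comm])
    (fun g i v => by simp)
  have hTtop : T = ⊤ := by
    rw [← Subgroup.index_eq_one]
    obtain ⟨k, hk⟩ := hP.index T
    rcases Nat.eq_zero_or_pos k with rfl | hk0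
    · simpa using hk
    · exact absurd ((dvd_pow_self p hk0.ne').trans (hk ▸ Dvd.intro _ hfin.symm)) hdim
  have hwconst : ∀ g, w g = w 1 := fun g => by
    have := (hT g).1 (hTtop ▸ Subgroup.mem_top g) 1
    simpa using this
  let U : Submodule ℂ V := ⨅ g : P, Module.End.eigenspace (ρ (g * a * g⁻¹)) (w 1)
  have hU : ∀ v, v ∈ U ↔ ∀ g : P, ρ (g * a * g⁻¹) v = w 1 • v := fun v => by
    simp [U, Submodule.mem_iInf, -map_mul]
  have hUtop : U = ⊤ := by
    refine hρ.eq_top (fun g v hv => ?_) (fun h => hX (le_bot_iff.1 (h ▸ fun v hv => ?_)))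
    · rw [hU] at hv ⊢
      intro h
      have h1 : ρ (h * a * h⁻¹) (ρ g v) = ρ g (ρ ((g⁻¹ * h) * a * (g⁻¹ * h)⁻¹) v) := by simp
      rw [h1, hv, map_smul]
    · rw [hU]
      intro g
      rw [hXw g v hv, hwconst]
  refine haS ⟨w 1, fun v => ?_⟩
  have := (hU v).1 (hUtop ▸ Submodule.mem_top) 1
  simpa using this

theorem exists_eigenvector_of_isPGroup {P : Type*} [Group P] [Finite P] {p : ℕ} [Fact p.Prime]
    (hP : IsPGroup p P) {V : Type*} [AddCommGroup V] [Module ℂ V] [FiniteDimensional ℂ V]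
    (ρ : Representation ℂ P V) (hdim : ¬ p ∣ finrank ℂ V) :
    ∃ v : V, v ≠ 0 ∧ ∃ c : P → ℂ, ∀ g, ρ g v = c g • v := by
  induction hn : finrank ℂ V using Nat.strong_induction_on generalizing V with
  | _ n ih =>
    have htop : (⊤ : Submodule ℂ V) ≠ ⊥ := by
      intro h
      apply hdim
      rw [← finrank_top, h, finrank_bot]
      exact dvd_zero p
    obtain ⟨U, hU, -, hirr⟩ := ρ.exists_isIrreducible_subrep ⊤ (by simp) htop
    have hnt := ((isIrreducible_iff_forall_submodule _).1 hirr).1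
    by_cases hpU : p ∣ finrank ℂ U
    · obtain ⟨U', hU', hc⟩ := ρ.exists_isCompl_invariant U hU
      have hadd := Submodule.finrank_add_eq_of_isCompl hc
      have hpos : 0 < finrank ℂ U := finrank_pos
      obtain ⟨v, hv, c, hvc⟩ := ih (finrank ℂ U') (by omega) (ρ.subrep U' hU')
        (fun h => hdim (hadd ▸ dvd_add hpU h)) rfl
      exact ⟨v, fun h => hv (Subtype.ext h), c, fun g => congrArg Subtype.val (hvc g)⟩
    · obtain ⟨v, hv⟩ := exists_ne (0 : U)
      choose c hc using hirr.isScalar_of_isPGroup hP hpU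
      exact ⟨v, fun h => hv (Subtype.ext h), c, fun g => congrArg Subtype.val (hc g v)⟩

end Representation

open Representation

/-- If all degrees are prime to `p`, then normal `p`-subgroups are abelian. -/
theorem DegreesPrimeTo.commute_of_normal {G : Type} [Group G] [Finite G] {p : ℕ} [Fact p.Prime]
    (hG : DegreesPrimeTo p G) (Q : Subgroup G) [Q.Normal] (hQ : IsPGroup p Q) {x y : G}
    (hx : x ∈ Q) (hy : y ∈ Q) : x * y = y * x := by
  refine eq_of_forall_isIrreducible _ _ fun V _ _ _ ρ hρ v => ?_
  let U : Submodule ℂ V :=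
    ⨅ a : Q, ⨅ b : Q, LinearMap.eqLocus (ρ ((a : G) * b)) (ρ ((b : G) * a))
  have hU : ∀ v, v ∈ U ↔ ∀ a ∈ Q, ∀ b ∈ Q, ρ (a * b) v = ρ (b * a) v := fun v => by
    simp [U, Submodule.mem_iInf, LinearMap.mem_eqLocus]
  have hUtop : U = ⊤ := by
    refine hρ.eq_top (fun g v hv => ?_) (fun h => ?_)
    · rw [hU] at hv ⊢
      intro a ha b hb
      have h1 : ∀ a b : G, ρ (a * b) (ρ g v) = ρ g (ρ ((g⁻¹ * a * g) * (g⁻¹ * b * g)) v) := by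
        intro a b; simp
      have hN : ∀ a ∈ Q, g⁻¹ * a * g ∈ Q := fun a ha => by
        simpa using Subgroup.Normal.conj_mem ‹_› a ha g⁻¹
      rw [h1, hv _ (hN a ha) _ (hN b hb), ← h1]
    · obtain ⟨v, hv, c, hc⟩ := exists_eigenvector_of_isPGroup hQ (ρ.comp Q.subtype) (hG V ρ hρ)
      have hc' : ∀ a (ha : a ∈ Q), ρ a v = c ⟨a, ha⟩ • v := fun a ha => hc ⟨a, ha⟩
      have : v ∈ U := by
        rw [hU]
        intro a ha b hb
        simp only [map_mul, Module.End.mul_apply, hc' a ha, hc' b hb, map_smul]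
        exact smul_comm _ _ _
      rw [h, Submodule.mem_bot] at this
      exact hv this
  exact (hU v).1 (hUtop ▸ Submodule.mem_top) x hx y hy

/-- If all degrees are prime to `p`, then a normal subgroup `R` which is contained in all overgroups
of `N` of index prime to `p` fixes every conjugacy class of the normal subgroup `N`. -/
theorem DegreesPrimeTo.exists_conj_eq {G : Type} [Group G] [Finite G] {p : ℕ}
    (hG : DegreesPrimeTo p G) (N R : Subgroup G) [N.Normal] [R.Normal]
    (hR : ∀ T : Subgroup G, N ≤ T → ¬ p ∣ T.index → R ≤ T) {x g : G} (hx : x ∈ N) (hg : g ∈ R) :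
    ∃ n ∈ N, g * x * g⁻¹ = n * x * n⁻¹ := by
  classical
  have := Fintype.ofFinite G
  have hconj : ∀ h, h * x * h⁻¹ ∈ N := fun h => Subgroup.Normal.conj_mem ‹_› x hx h
  let s : G → G → ℂ := fun y z => ∑ n : N, Pi.single (M := fun _ => ℂ) ((n : G) * y * (n : G)⁻¹) 1 z
  have hs : s (g * x * g⁻¹) - s x = 0 := by
    refine eq_zero_of_forall_isIrreducible _ fun V _ _ _ ρ hρ v => ?_
    let C : G → End ℂ V := fun y => ∑ n : N, ρ (n * y * (n : G)⁻¹)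
    have hC : ∀ y v, C y v = ∑ n : N, ρ (n * y * (n : G)⁻¹) v := fun y v => by
      simp [C, LinearMap.sum_apply]
    have hsC : ∀ y, ∑ z, s y z • ρ z v = C y v := by
      intro y
      simp only [s, hC, Finset.sum_smul]
      rw [Finset.sum_comm]
      simp [Pi.single_apply, ite_smul]
    have hCN : ∀ y, ∀ m ∈ N, C (m * y * m⁻¹) = C y := by
      intro y m hm
      refine Fintype.sum_equiv (Equiv.mulRight (⟨m, hm⟩ : N)) _ _ fun n => ?_
      simp [mul_assoc]
    have hCG : ∀ h y v, C (h * y * h⁻¹) (ρ h v) = ρ h (C y v) := by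
      intro h y v
      rw [hC, hC, map_sum]
      refine Fintype.sum_equiv (MulAut.conjNormal h⁻¹ : MulAut N).toEquiv _ _ fun n => ?_
      simp [mul_assoc]
    have hcomm : ∀ y, ∀ m ∈ N, Commute (C y) (ρ m) := by
      intro y m hm
      ext v
      rw [Module.End.mul_apply, Module.End.mul_apply, ← hCG, hCN y m hm]
    obtain ⟨w, X, T, hX, hXw, hT, -, hfin⟩ := hρ.exists_weight (ι := G)
      (fun h => C (h * x * h⁻¹))
      (fun i j => Commute.sum_right _ _ _ fun n _ => hcomm _ _
        (Subgroup.Normal.conj_mem ‹_› _ (hconj j) _))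
      (fun h i v => by
        rw [← hCG]; simp [mul_assoc])
    have hXv : ∃ v ∈ X, v ≠ 0 := Submodule.exists_mem_ne_zero_of_ne_bot hX
    have hNT : N ≤ T := by
      intro m hm
      rw [hT]
      intro i
      obtain ⟨v, hv, hv0⟩ := hXv
      have h1 := hXw (m • i) v hv
      have h2 := hXw i v hv
      have h3 : C ((m • i) * x * (m • i)⁻¹) = C (i * x * i⁻¹) := by
        rw [← hCN (i * x * i⁻¹) m hm]; simp [mul_assoc]
      rw [h3, h2] at h1
      exact (smul_left_injective ℂ hv0 h1).symm
    have hRT : R ≤ T := hR T hNT fun h => hG V ρ hρ (hfin ▸ h.mul_right _)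
    let U : Submodule ℂ V := ⨅ h : G, ⨅ r : R,
      LinearMap.eqLocus (C (r * h * x * ((r : G) * h)⁻¹)) (C (h * x * h⁻¹))
    have hU : ∀ v, v ∈ U ↔ ∀ h, ∀ r ∈ R, C (r * h * x * (r * h)⁻¹) v = C (h * x * h⁻¹) v :=
      fun v => by simp [U, Submodule.mem_iInf, LinearMap.mem_eqLocus]
    have hUtop : U = ⊤ := by
      refine hρ.eq_top (fun k v hv => ?_) (fun h => hX (le_bot_iff.1 (h ▸ fun v hv => ?_)))
      · rw [hU] at hv ⊢
        intro h r hr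
        have h1 : ∀ y, C y (ρ k v) = ρ k (C (k⁻¹ * y * k) v) := fun y => by
          rw [← hCG]; simp [mul_assoc]
        have h2 := hv (k⁻¹ * h) (k⁻¹ * r * k) (by simpa using Subgroup.Normal.conj_mem ‹_› r hr k⁻¹)
        rw [h1, h1]
        simp only [mul_assoc, mul_inv_rev, inv_inv, mul_inv_cancel_left] at h2 ⊢
        rw [h2]
      · rw [hU]
        intro h r hr
        rw [hXw (r * h) v hv, hXw h v hv, ← (hT r).1 (hRT hr) h, smul_eq_mul]
    have := (hU v).1 (hUtop ▸ Submodule.mem_top) 1 g hg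
    simp only [Pi.sub_apply, sub_smul, Finset.sum_sub_distrib, hsC]
    simpa [sub_eq_zero] using this
  by_contra! hne
  have h1 := congrFun hs (g * x * g⁻¹)
  have h2 : s x (g * x * g⁻¹) = 0 := by
    refine Finset.sum_eq_zero fun n _ => ?_
    rw [Pi.single_eq_of_ne (hne n n.2)]
  have h3 : s (g * x * g⁻¹) (g * x * g⁻¹) =
      (Finset.univ.filter fun n : N => (n : G) * (g * x * g⁻¹) * (n : G)⁻¹ = g * x * g⁻¹).card := by
    simp only [s, Pi.single_apply]
    rw [Finset.card_filter]
    push_cast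
    exact Finset.sum_congr rfl fun n _ => by simp [eq_comm]
  rw [Pi.sub_apply, h2, h3, sub_zero, Pi.zero_apply, Nat.cast_eq_zero, Finset.card_eq_zero,
    Finset.filter_eq_empty_iff] at h1
  exact h1 (Finset.mem_univ 1) (by simp)

/-- An irreducible quotient of a representation is isomorphic to a subrepresentation. -/
theorem Representation.IsIrreducible.exists_equiv_submodule {T V U : Type*} [Group T] [Finite T]
    [AddCommGroup V] [Module ℂ V] [AddCommGroup U] [Module ℂ U] {ρ : Representation ℂ T V}
    {σ : Representation ℂ T U} (hσ : σ.IsIrreducible) (f : V →ₗ[ℂ] U)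
    (hfT : ∀ t v, f (ρ t v) = σ t (f v)) {v : V} (hv : f v ≠ 0) :
    ∃ (X : Submodule ℂ V) (e : X ≃ₗ[ℂ] U),
      ∀ (t : T) (x : X), ∃ hx : ρ t x ∈ X, e ⟨ρ t x, hx⟩ = σ t (e x) := by
  have hker : ∀ t : T, ∀ v ∈ LinearMap.ker f, ρ t v ∈ LinearMap.ker f := fun t v hv => by
    rw [LinearMap.mem_ker] at hv ⊢
    rw [hfT, hv, map_zero]
  obtain ⟨X, hX, hc⟩ := ρ.exists_isCompl_invariant (LinearMap.ker f) hker
  have hinj : Function.Injective (f.domRestrict X) := by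
    rw [← LinearMap.ker_eq_bot, LinearMap.ker_domRestrict, ← Submodule.disjoint_iff_comap_eq_bot]
    exact hc.disjoint.symm
  have hsurj : Function.Surjective (f.domRestrict X) := by
    rw [← LinearMap.range_eq_top]
    refine hσ.eq_top ?_ ?_
    · rintro t _ ⟨x, rfl⟩
      exact ⟨⟨ρ t x, hX t x x.2⟩, hfT t x⟩
    · intro h
      have h0 : X ≤ LinearMap.ker f := by
        intro x hx
        have : f.domRestrict X ⟨x, hx⟩ ∈ LinearMap.range (f.domRestrict X) := ⟨_, rfl⟩
        rw [h] at this
        exact this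
      have : LinearMap.ker f = ⊤ := by
        rw [← hc.sup_eq_top, left_eq_sup]; exact h0
      exact hv (LinearMap.mem_ker.1 (this ▸ Submodule.mem_top))
  exact ⟨X, LinearEquiv.ofBijective (f.domRestrict X) ⟨hinj, hsurj⟩,
    fun t x => ⟨hX t x x.2, hfT t x⟩⟩

theorem Representation.IsIrreducible.exists_extension_of_hom {G : Type*} [Group G] [Finite G]
    (T : Subgroup G) {U : Type*} [AddCommGroup U] [Module ℂ U] {σ : Representation ℂ T U}
    (hσ : σ.IsIrreducible) {W : Type} [AddCommGroup W] [Module ℂ W] [FiniteDimensional ℂ W]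
    [Nontrivial W] (τ : Representation ℂ G W) (f : W →ₗ[ℂ] U)
    (hfT : ∀ (t : T) w, f (τ t w) = σ t (f w)) (hf : ∀ w, (∀ g, f (τ g w) = 0) → w = 0) :
    ∃ (V : Type) (_ : AddCommGroup V) (_ : Module ℂ V) (_ : FiniteDimensional ℂ V)
      (ρ : Representation ℂ G V) (X : Submodule ℂ V) (e : X ≃ₗ[ℂ] U), ρ.IsIrreducible ∧
      ∀ (t : T) (x : X), ∃ hx : ρ t x ∈ X, e ⟨ρ t x, hx⟩ = σ t (e x) := by
  obtain ⟨V, hV, -, hirr⟩ := τ.exists_isIrreducible_subrep ⊤ (by simp) top_ne_bot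
  have hVnt := ((isIrreducible_iff_forall_submodule _).1 hirr).1
  obtain ⟨v, hv⟩ : ∃ v, (f ∘ₗ V.subtype) v ≠ 0 := by
    by_contra! h
    obtain ⟨v, hv⟩ := exists_ne (0 : V)
    exact hv (Subtype.ext (hf v fun g => h (τ.subrep V hV g v)))
  obtain ⟨X, e, he⟩ := hσ.exists_equiv_submodule (ρ := (τ.subrep V hV).comp T.subtype)
    (f ∘ₗ V.subtype) (fun t v => hfT t v) hv
  exact ⟨V, inferInstance, inferInstance, inferInstance, τ.subrep V hV, X, e, hirr, he⟩

/-- Every irreducible representation of a subgroup occurs in the restriction of an irreducible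
representation of the whole group. -/
theorem Representation.IsIrreducible.exists_extension {G : Type} [Group G] [Finite G]
    (T : Subgroup G) {U : Type} [AddCommGroup U] [Module ℂ U] [FiniteDimensional ℂ U]
    {σ : Representation ℂ T U} (hσ : σ.IsIrreducible) :
    ∃ (V : Type) (_ : AddCommGroup V) (_ : Module ℂ V) (_ : FiniteDimensional ℂ V)
      (ρ : Representation ℂ G V) (X : Submodule ℂ V) (e : X ≃ₗ[ℂ] U), ρ.IsIrreducible ∧
      ∀ (t : T) (x : X), ∃ hx : ρ t x ∈ X, e ⟨ρ t x, hx⟩ = σ t (e x) := by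
  classical
  have hU := ((isIrreducible_iff_forall_submodule _).1 hσ).1
  let τ := Representation.coind T.subtype σ
  have hτ : ∀ g (f : coindV T.subtype σ) x, (τ g f).1 x = f.1 (x * g) := fun g f x => rfl
  have hne : Nontrivial (coindV T.subtype σ) := by
    obtain ⟨u, hu⟩ := exists_ne (0 : U)
    let f : G → U := fun g => if h : g ∈ T then σ ⟨g, h⟩ u else 0
    have hf : f ∈ coindV T.subtype σ := by
      rw [mem_coindV]
      intro t g
      by_cases hg : g ∈ T
      · have : (t : G) * g ∈ T := T.mul_mem t.2 hg
        simp only [f, Subgroup.subtype_apply, hg, this, dif_pos]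
        rw [← Module.End.mul_apply, ← map_mul]
        rfl
      · have : (t : G) * g ∉ T := fun h => hg ((T.mul_mem_cancel_left t.2).1 h)
        simp [f, hg, this]
    refine ⟨⟨f, hf⟩, 0, fun h0 => ?_⟩
    have h1 := congrFun (congrArg Subtype.val h0) 1
    apply hu
    have h2 : f 1 = u := by
      have : σ ⟨1, T.one_mem⟩ = 1 := map_one σ
      simp [f, T.one_mem, this]
    rw [← h2]; exact h1
  refine hσ.exists_extension_of_hom T τ
    (LinearMap.proj 1 ∘ₗ (coindV T.subtype σ).subtype) (fun t f => ?_) fun f h => ?_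
  · have := (mem_coindV _ _ _).1 f.2 t 1
    change (τ t f).1 1 = σ t (f.1 1)
    rw [hτ]
    simpa using this
  · refine Subtype.ext (funext fun g => ?_)
    have := h g
    change (τ g f).1 1 = 0 at this
    rwa [hτ, one_mul] at this

/-- If all irreducible representations that are nontrivial on a nontrivial normal abelian
`p`-subgroup `N` have degree prime to `p`, then some overgroup of `N` of index prime to `p` has all
its degrees modulo `N` prime to `p`. -/
theorem exists_degreesPrimeTo_quotient {G : Type} [Group G] [Finite G] {p : ℕ} [Fact p.Prime]
    (N : Subgroup G) [N.Normal] (hN : IsPGroup p N) (hab : ∀ x ∈ N, ∀ y ∈ N, x * y = y * x)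
    (hne : N ≠ ⊥) (h : ∀ (V : Type) [AddCommGroup V] [Module ℂ V] [FiniteDimensional ℂ V]
      (ρ : Representation ℂ G V), ρ.IsIrreducible → (∃ n ∈ N, ρ n ≠ 1) → ¬ p ∣ finrank ℂ V) :
    ∃ T : Subgroup G, N ≤ T ∧ ¬ p ∣ T.index ∧ DegreesPrimeTo p (T ⧸ N.subgroupOf T) := by
  obtain ⟨V, _, _, _, ρ, hρ, n₀, hn₀, hρn₀⟩ : ∃ (V : Type) (_ : AddCommGroup V) (_ : Module ℂ V)
      (_ : FiniteDimensional ℂ V) (ρ : Representation ℂ G V), ρ.IsIrreducible ∧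
      ∃ n ∈ N, ρ n ≠ 1 := by
    by_contra! hcon
    refine hne ((Subgroup.eq_bot_iff_forall N).2 fun n hn => ?_)
    refine eq_of_forall_isIrreducible n 1 fun V _ _ _ ρ hρ v => ?_
    rw [hcon V _ _ inferInstance ρ hρ n hn, map_one]
  have hd := h V ρ hρ ⟨n₀, hn₀, hρn₀⟩
  let _ : MulAction G N := MulAction.compHom N (MulAut.conjNormal : G →* MulAut N)
  have hsmul : ∀ (g : G) (n : N), ((g • n : N) : G) = g * n * g⁻¹ := fun g n =>
    MulAut.conjNormal_apply g n
  have hequiv : ∀ {W : Type} [AddCommGroup W] [Module ℂ W] (τ : Representation ℂ G W) (g : G)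
      (n : N) (v : W), τ (g • n : N) (τ g v) = τ g (τ n v) := fun τ g n v => by
    rw [hsmul]; simp
  have hcomm : ∀ {W : Type} [AddCommGroup W] [Module ℂ W] (τ : Representation ℂ G W) (i j : N),
      Commute (τ i : End ℂ W) (τ j) := fun τ i j => by
    rw [Commute, SemiconjBy, ← map_mul, ← map_mul, hab i i.2 j j.2]
  obtain ⟨w, X, T, hX, hXw, hT, hXT, hfin⟩ := hρ.exists_weight (fun n : N => ρ n) (hcomm ρ)
    (hequiv ρ)
  obtain ⟨x, hxX, hx0⟩ := Submodule.exists_mem_ne_zero_of_ne_bot hX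
  have hNT : N ≤ T := by
    intro m hm
    rw [hT]
    intro n
    congr 1
    ext
    rw [hsmul, hab m hm n n.2, mul_inv_cancel_right]
  have hw1 : w 1 = 1 := by
    have := hXw 1 x hxX
    rw [Subgroup.coe_one, map_one, Module.End.one_apply] at this
    exact smul_left_injective ℂ hx0 (by simpa using this.symm)
  have hwmul : ∀ a b, w (a * b) = w a * w b := by
    intro a b
    have := hXw (a * b) x hxX
    rw [Subgroup.coe_mul, map_mul, Module.End.mul_apply, hXw b x hxX, map_smul, hXw a x hxX,
      smul_smul] at this
    rw [mul_comm (w a)]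
    exact smul_left_injective ℂ hx0 this.symm
  have hwpow : ∀ a (k : ℕ), w (a ^ k) = w a ^ k := by
    intro a k
    induction k with
    | zero => simp [hw1]
    | succ k ih => rw [pow_succ, hwmul, ih, pow_succ]
  obtain ⟨n₁, hn₁⟩ : ∃ n, w n ≠ 1 := by
    by_contra! hcon
    let Y : Submodule ℂ V := ⨅ n : N, LinearMap.eqLocus (ρ n) LinearMap.id
    have hY : ∀ v, v ∈ Y ↔ ∀ n : N, ρ n v = v := fun v => by
      simp [Y, Submodule.mem_iInf, LinearMap.mem_eqLocus]
    have hYtop : Y = ⊤ := by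
      refine hρ.eq_top (fun g v hv => ?_) (fun h0 => hx0 ?_)
      · rw [hY] at hv ⊢
        intro n
        have := hequiv ρ g (g⁻¹ • n) v
        rwa [smul_inv_smul, hv] at this
      · rw [← Submodule.mem_bot ℂ, ← h0, hY]
        intro n
        rw [hXw n x hxX, hcon, one_smul]
    refine hρn₀ (LinearMap.ext fun v => ?_)
    exact (hY v).1 (hYtop ▸ Submodule.mem_top) ⟨n₀, hn₀⟩
  have hdX : ¬ p ∣ finrank ℂ X := fun hp => hd (hfin ▸ hp.mul_left _)
  -- the weight extends to `T`, using the determinant on the weight space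
  obtain ⟨η, hη⟩ : ∃ η : T →* ℂˣ, ∀ n (hn : n ∈ N), (η ⟨n, hNT hn⟩ : ℂ) = w ⟨n, hn⟩ := by
    let τ : Representation ℂ T X := subrep (ρ.comp T.subtype) X fun t v hv => hXT t t.2 v hv
    let δ : T →* ℂˣ := ((LinearMap.det : End ℂ X →* ℂ).comp τ).toHomUnits
    have hδ : ∀ n (hn : n ∈ N), (δ ⟨n, hNT hn⟩ : ℂ) = w ⟨n, hn⟩ ^ finrank ℂ X := by
      intro n hn
      have : τ ⟨n, hNT hn⟩ = w ⟨n, hn⟩ • LinearMap.id := by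
        ext v
        exact hXw ⟨n, hn⟩ v v.2
      change LinearMap.det (τ ⟨n, hNT hn⟩) = _
      rw [this, LinearMap.det_smul, LinearMap.det_id, mul_one]
    have hcop : Nat.Coprime (finrank ℂ X) (Nat.card N) := by
      obtain ⟨k, hk⟩ := IsPGroup.iff_card.1 hN
      rw [hk]
      exact (((Fact.out : p.Prime).coprime_iff_not_dvd.2 hdX).symm).pow_right k
    obtain ⟨m, -, hm⟩ := Nat.exists_mul_mod_eq_one_of_coprime hcop
      ((Subgroup.one_lt_card_iff_ne_bot N).2 hne)
    refine ⟨δ ^ m, fun n hn => ?_⟩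
    have hcard : w ⟨n, hn⟩ ^ Nat.card N = 1 := by rw [← hwpow, pow_card_eq_one', hw1]
    rw [MonoidHom.pow_apply, Units.val_pow_eq_pow_val, hδ, ← pow_mul,
      ← Nat.div_add_mod (finrank ℂ X * m) (Nat.card N), hm, pow_add, pow_mul, hcard, one_pow,
      one_mul, pow_one]
  refine ⟨T, hNT, fun hp => hd (hfin ▸ hp.mul_right _), ?_⟩
  intro U _ _ _ σ hσ hpU
  let τ : Representation ℂ T U :=
    { toFun := fun t => (η t : ℂ) • σ t
      map_one' := by simp
      map_mul' := fun a b => by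
        ext v
        simp [smul_smul, mul_comm] }
  have hτ : ∀ t v, τ t v = (η t : ℂ) • σ t v := fun t v => rfl
  have hτirr : τ.IsIrreducible := by
    rw [isIrreducible_iff_forall_submodule] at hσ ⊢
    refine ⟨hσ.1, fun W hW => hσ.2 W fun g v hv => ?_⟩
    obtain ⟨t, rfl⟩ := QuotientGroup.mk_surjective g
    have := hW t v hv
    rw [hτ] at this
    exact (Submodule.smul_mem_iff W (η t).ne_zero).1 this
  obtain ⟨V', _, _, _, ρ', X', e, hρ', he⟩ := hτirr.exists_extension
  have hU := ((isIrreducible_iff_forall_submodule _).1 hσ).1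
  have hX'w : ∀ n : N, ∀ v ∈ X', ρ' n v = w n • v := by
    intro n v hv
    obtain ⟨h1, h2⟩ := he ⟨n, hNT n.2⟩ ⟨v, hv⟩
    have h3 : σ ((⟨n, hNT n.2⟩ : T) : T ⧸ N.subgroupOf T) = 1 := by
      have h4 : ((⟨n, hNT n.2⟩ : T) : T ⧸ N.subgroupOf T) = 1 :=
        (QuotientGroup.eq_one_iff _).2 (Subgroup.mem_subgroupOf.2 n.2)
      rw [h4, map_one]
    rw [hτ, h3, hη n n.2, Module.End.one_apply, ← map_smul] at h2
    exact congrArg Subtype.val (e.injective h2)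
  have hX' : X' ≠ ⊥ := Submodule.nontrivial_iff_ne_bot.1 e.toEquiv.nontrivial
  have hfin' := hρ'.finrank_eq_index_mul (fun n : N => ρ' n) (hcomm ρ') (hequiv ρ') w X' hX' hX'w T
    hT (fun g hg v hv => (he ⟨g, hg⟩ ⟨v, hv⟩).1)
  refine h V' ρ' hρ' ⟨n₁, n₁.2, fun h1 => ?_⟩ ?_
  · obtain ⟨v, hv, hv0⟩ := Submodule.exists_mem_ne_zero_of_ne_bot hX'
    have := hX'w n₁ v hv
    rw [h1, Module.End.one_apply] at this
    exact hn₁ (smul_left_injective ℂ hv0 (by simpa using this.symm))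
  · rw [hfin', e.finrank_eq]
    exact hpU.mul_left _

namespace IsPSolvable

variable {G : Type*} [Group G] {p : ℕ}

theorem of_isSimpleGroup (hG : IsPSolvable p G) (H : Subgroup G) {S : Type*} [Group S]
    (f : H →* S) (hf : Function.Surjective f) (hS : IsSimpleGroup S) :
    IsPGroup p S ∨ ¬ p ∣ Nat.card S := by
  have e := QuotientGroup.quotientKerEquivOfSurjective f hf
  have : Nontrivial (H ⧸ f.ker) := e.toEquiv.nontrivial
  have hs : IsSimpleGroup (H ⧸ f.ker) :=
    IsSimpleGroup.isSimpleGroup_of_surjective e.symm.toMonoidHom e.symm.surjective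
  rcases hG H f.ker hs with h | h
  · exact Or.inl (h.of_equiv e)
  · exact Or.inr (Nat.card_congr e.toEquiv ▸ h)

theorem subgroup (hG : IsPSolvable p G) (T : Subgroup G) : IsPSolvable p T := fun H K _ hs =>
  hG.of_isSimpleGroup (H.map T.subtype)
    ((QuotientGroup.mk' K).comp
      (H.equivMapOfInjective T.subtype T.subtype_injective).symm.toMonoidHom)
    ((QuotientGroup.mk'_surjective K).comp (MulEquiv.surjective _)) hs

theorem quotient (hG : IsPSolvable p G) (N : Subgroup G) [N.Normal] : IsPSolvable p (G ⧸ N) :=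
  fun H K _ hs => by
    refine hG.of_isSimpleGroup (H.comap (QuotientGroup.mk' N))
      ((QuotientGroup.mk' K).comp ((QuotientGroup.mk' N).subgroupComap H))
      ((QuotientGroup.mk'_surjective K).comp
        ((QuotientGroup.mk' N).subgroupComap_surjective_of_surjective H
          (QuotientGroup.mk'_surjective N))) hs

theorem exists_normal [Finite G] [Nontrivial G] [hp : Fact p.Prime] (hG : IsPSolvable p G) :
    ∃ N : Subgroup G, N.Normal ∧ N ≠ ⊥ ∧ (IsPGroup p N ∨ ¬ p ∣ Nat.card N) := by
  obtain ⟨N, ⟨hN, hN0⟩, hmin⟩ := WellFounded.has_min (wellFounded_lt (α := Subgroup G))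
    {N | N.Normal ∧ N ≠ ⊥} ⟨⊤, inferInstance, top_ne_bot⟩
  refine ⟨N, hN, hN0, ?_⟩
  have hNnt : Nontrivial N := N.nontrivial_iff_ne_bot.2 hN0
  obtain ⟨K, ⟨hK, hK1⟩, hmax⟩ := WellFounded.has_min (wellFounded_gt (α := Subgroup N))
    {K | K.Normal ∧ K ≠ ⊤} ⟨⊥, inferInstance, bot_ne_top⟩
  have hnt : Nontrivial (N ⧸ K) := QuotientGroup.nontrivial_iff.2 hK1
  have hsimple : IsSimpleGroup (N ⧸ K) := by
    refine ⟨fun L hL => ?_⟩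
    have hle : K ≤ L.comap (QuotientGroup.mk' K) := by
      simpa using (QuotientGroup.mk' K).ker_le_comap L
    have hinj := Subgroup.comap_injective (QuotientGroup.mk'_surjective K)
    by_cases h : L.comap (QuotientGroup.mk' K) = ⊤
    · exact Or.inr (hinj (by rw [h, Subgroup.comap_top]))
    · left
      have := hmax (L.comap (QuotientGroup.mk' K)) ⟨inferInstance, h⟩
      refine hinj ?_
      rw [MonoidHom.comap_bot, QuotientGroup.ker_mk']
      exact (hle.eq_of_not_lt this).symm
  have hcore : (K.map N.subtype).normalCore = ⊥ := by
    by_contra h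
    have hle : (K.map N.subtype).normalCore ≤ K.map N.subtype := Subgroup.normalCore_le _
    have hle' : K.map N.subtype ≤ N := Subgroup.map_subtype_le K
    have := (hle.trans hle').eq_of_not_lt (hmin _ ⟨inferInstance, h⟩)
    have h2 : K.map N.subtype = N := le_antisymm hle' (this.symm.le.trans hle)
    refine hK1 (eq_top_iff.2 fun x _ => ?_)
    obtain ⟨y, hy, hyx⟩ := h2.symm.le x.2
    rwa [← Subtype.ext hyx]
  have hpow : ∀ x : N, x ^ Nat.card (N ⧸ K) = 1 := by
    intro x
    have : ((x : G) ^ Nat.card (N ⧸ K)) ∈ (K.map N.subtype).normalCore := by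
      intro g
      refine ⟨⟨g * x * g⁻¹, hN.conj_mem x x.2 g⟩ ^ Nat.card (N ⧸ K), ?_, by simp [conj_pow]⟩
      rw [SetLike.mem_coe, ← QuotientGroup.eq_one_iff, QuotientGroup.mk_pow, pow_card_eq_one']
    rw [hcore, Subgroup.mem_bot] at this
    exact Subtype.ext this
  rcases hG N K hsimple with h | h
  · left
    obtain ⟨k, hk⟩ := IsPGroup.iff_card.1 h
    exact fun x => ⟨k, hk ▸ hpow x⟩
  · right
    intro hdvd
    obtain ⟨x, hx⟩ := exists_prime_orderOf_dvd_card' p hdvd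
    exact h (hx ▸ orderOf_dvd_of_pow_eq_one (hpow x))

theorem exists_normal_comm [Finite G] [Nontrivial G] [hp : Fact p.Prime] (hG : IsPSolvable p G) :
    ∃ N : Subgroup G, N.Normal ∧ N ≠ ⊥ ∧
      (IsPGroup p N ∧ (∀ x ∈ N, ∀ y ∈ N, x * y = y * x) ∨ ¬ p ∣ Nat.card N) := by
  obtain ⟨N, hN, hN0, h | h⟩ := hG.exists_normal
  · have hNnt : Nontrivial N := N.nontrivial_iff_ne_bot.2 hN0
    have := h.center_nontrivial
    have hle : (Subgroup.center N).map N.subtype ≤ N := Subgroup.map_subtype_le _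
    refine ⟨(Subgroup.center N).map N.subtype, inferInstance, ?_, Or.inl ⟨h.to_le hle, ?_⟩⟩
    · rw [Ne, Subgroup.map_eq_bot_iff_of_injective _ N.subtype_injective,
        ← Ne, ← Subgroup.nontrivial_iff_ne_bot]
      exact this
    · rintro _ ⟨x, hx, rfl⟩ _ ⟨y, -, rfl⟩
      rw [← map_mul, ← map_mul, Subgroup.mem_center_iff.1 hx y]
  · exact ⟨N, hN, hN0, Or.inr h⟩

end IsPSolvable

theorem IsPGroup.exists_conj_mem {G : Type*} [Group G] [Finite G] {p : ℕ} [hp : Fact p.Prime]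
    {P : Subgroup G} (hP : IsPGroup p P) {T : Subgroup G} (hT : ¬ p ∣ T.index) :
    ∃ g : G, ∀ x ∈ P, g⁻¹ * x * g ∈ T := by
  obtain ⟨c, hc⟩ := hP.nonempty_fixed_point_of_prime_not_dvd_card (G ⧸ T) hT
  obtain ⟨g, rfl⟩ := QuotientGroup.mk_surjective c
  refine ⟨g, fun x hx => ?_⟩
  have := hc ⟨x, hx⟩
  change ((x * g : G) : G ⧸ T) = g at this
  rw [eq_comm, QuotientGroup.eq] at this
  rwa [mul_assoc]

theorem IsPGroup.le_of_normal {G : Type*} [Group G] [Finite G] {p : ℕ} [Fact p.Prime]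
    {P : Subgroup G} (hP : IsPGroup p P) {Q : Subgroup G} [Q.Normal] (hQ : ¬ p ∣ Q.index) :
    P ≤ Q := by
  obtain ⟨g, hg⟩ := hP.exists_conj_mem hQ
  intro x hx
  have := Subgroup.Normal.conj_mem ‹_› _ (hg x hx) g
  simpa [mul_assoc] using this

theorem IsPGroup.normal_le {G : Type*} [Group G] [Finite G] {p : ℕ} [Fact p.Prime]
    {P : Subgroup G} [P.Normal] (hP : IsPGroup p P) {T : Subgroup G} (hT : ¬ p ∣ T.index) :
    P ≤ T := by
  obtain ⟨g, hg⟩ := hP.exists_conj_mem hT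
  intro x hx
  have := hg _ (Subgroup.Normal.conj_mem ‹_› x hx g)
  simpa [mul_assoc] using this

/-- A subgroup of a finite group which meets every conjugacy class is the whole group. -/
theorem Subgroup.eq_top_of_forall_exists_conj_mem {G : Type*} [Group G] [Finite G]
    (H : Subgroup G) (h : ∀ x, ∃ g, g * x * g⁻¹ ∈ H) : H = ⊤ := by
  classical
  have := Fintype.ofFinite G
  have := Fintype.ofFinite (G ⧸ H)
  have key := MulAction.sum_card_fixedBy_eq_card_orbits_mul_card_group G (G ⧸ H)
  have horb : Fintype.card (Quotient (MulAction.orbitRel G (G ⧸ H))) = 1 := by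
    rw [Fintype.card_eq_one_iff_nonempty_unique]
    exact (MulAction.pretransitive_iff_unique_quotient_of_nonempty G (G ⧸ H)).1 inferInstance
  rw [horb, one_mul] at key
  have hpos : ∀ x : G, 1 ≤ Fintype.card (MulAction.fixedBy (G ⧸ H) x) := by
    intro x
    obtain ⟨g, hg⟩ := h x
    refine Fintype.card_pos_iff.2 ⟨⟨(g⁻¹ : G), ?_⟩⟩
    change ((x * g⁻¹ : G) : G ⧸ H) = (g⁻¹ : G)
    rw [eq_comm, QuotientGroup.eq]
    simpa [mul_assoc] using hg
  have hone : Fintype.card (MulAction.fixedBy (G ⧸ H) (1 : G)) = 1 := by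
    by_contra hne
    have hlt : ∑ _x : G, 1 < ∑ x : G, Fintype.card (MulAction.fixedBy (G ⧸ H) x) :=
      Finset.sum_lt_sum (fun x _ => hpos x)
        ⟨1, Finset.mem_univ 1, lt_of_le_of_ne (hpos 1) (Ne.symm hne)⟩
    rw [key] at hlt
    simp at hlt
  rw [← Subgroup.index_eq_one, Subgroup.index, Nat.card_eq_fintype_card, ← hone]
  refine Fintype.card_congr (Equiv.subtypeUnivEquiv fun c => ?_).symm
  exact one_smul G c

/-- A `p`-subgroup whose conjugation action preserves every conjugacy class of a normal subgroup
of order prime to `p` centralizes that subgroup. -/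
theorem IsPGroup.commute_of_exists_conj {G : Type*} [Group G] [Finite G] {p : ℕ} [Fact p.Prime]
    {P : Subgroup G} (hP : IsPGroup p P) (N : Subgroup G) [hN : N.Normal]
    (hpN : ¬ p ∣ Nat.card N)
    (h : ∀ x ∈ N, ∀ g ∈ P, ∃ n ∈ N, g * x * g⁻¹ = n * x * n⁻¹) {x g : G} (hx : x ∈ N)
    (hg : g ∈ P) : g * x = x * g := by
  let H : Subgroup N := (Subgroup.centralizer (P : Set G)).subgroupOf N
  have hH : H = ⊤ := by
    refine H.eq_top_of_forall_exists_conj_mem fun x => ?_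
    let C : Set N := MulAction.orbit (ConjAct N) x
    have hC : ∀ y, y ∈ C ↔ ∃ n : N, n * x * n⁻¹ = y := fun y => Iff.rfl
    have hmem : ∀ g : P, ∀ y ∈ C, MulAut.conjNormal (g : G) y ∈ C := by
      intro g y hy
      obtain ⟨n, rfl⟩ := (hC y).1 hy
      obtain ⟨m, hm, hgm⟩ := h x x.2 g g.2
      refine (hC _).2 ⟨MulAut.conjNormal (g : G) n * ⟨m, hm⟩, Subtype.ext ?_⟩
      calc ((g : G) * n * (g : G)⁻¹ * m) * x * ((g : G) * n * (g : G)⁻¹ * m)⁻¹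
          = (g : G) * n * (g : G)⁻¹ * (m * x * m⁻¹) * ((g : G) * n * (g : G)⁻¹)⁻¹ := by group
        _ = (g : G) * n * (g : G)⁻¹ * (g * x * (g : G)⁻¹) * ((g : G) * n * (g : G)⁻¹)⁻¹ := by
          rw [hgm]
        _ = (g : G) * (n * x * (n : G)⁻¹) * (g : G)⁻¹ := by group
    let _ : MulAction P C :=
      { smul := fun g y => ⟨MulAut.conjNormal (g : G) y.1, hmem g y y.2⟩
        one_smul := fun y => Subtype.ext (by
          change MulAut.conjNormal ((1 : P) : G) y.1 = y.1
          simp)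
        mul_smul := fun a b y => Subtype.ext (by
          change MulAut.conjNormal ((a * b : P) : G) y.1 =
            MulAut.conjNormal (a : G) (MulAut.conjNormal (b : G) y.1)
          simp) }
    have hcard : ¬ p ∣ Nat.card C := by
      intro hdvd
      have hidx := MulAction.index_stabilizer (ConjAct N) x
      have := Subgroup.index_dvd_card (MulAction.stabilizer (ConjAct N) x)
      rw [hidx] at this
      exact hpN (hdvd.trans this)
    obtain ⟨⟨y, hy⟩, hfix⟩ := hP.nonempty_fixed_point_of_prime_not_dvd_card C hcard
    obtain ⟨n, rfl⟩ := (hC y).1 hy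
    refine ⟨n, Subgroup.mem_subgroupOf.2 (Subgroup.mem_centralizer_iff.2 fun g hg => ?_)⟩
    have := congrArg (fun z : C => (z.1 : G)) (hfix ⟨g, hg⟩)
    change g * _ * g⁻¹ = _ at this
    exact mul_inv_eq_iff_eq_mul.1 this
  have : (⟨x, hx⟩ : N) ∈ H := hH ▸ Subgroup.mem_top _
  exact Subgroup.mem_centralizer_iff.1 (Subgroup.mem_subgroupOf.1 this) g hg

theorem Representation.IsIrreducible.comp_mk' {G V : Type*} [Group G] [AddCommGroup V] [Module ℂ V]
    (N : Subgroup G) [N.Normal] {ρ : Representation ℂ (G ⧸ N) V} (hρ : ρ.IsIrreducible) :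
    Representation.IsIrreducible (ρ.comp (QuotientGroup.mk' N)) := by
  rw [isIrreducible_iff_forall_submodule] at hρ ⊢
  refine ⟨hρ.1, fun W hW => hρ.2 W fun g v hv => ?_⟩
  obtain ⟨t, rfl⟩ := QuotientGroup.mk_surjective g
  exact hW t v hv

theorem DegreesPrimeTo.quotient {G : Type} [Group G] {p : ℕ} (hG : DegreesPrimeTo p G)
    (N : Subgroup G) [N.Normal] : DegreesPrimeTo p (G ⧸ N) := fun V _ _ _ _ hρ =>
  hG V _ (hρ.comp_mk' N)

theorem Subgroup.card_quotient_lt {G : Type*} [Group G] [Finite G] {N : Subgroup G}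
    (hN : N ≠ ⊥) : Nat.card (G ⧸ N) < Nat.card G := by
  rw [Subgroup.card_eq_card_quotient_mul_card_subgroup N]
  exact lt_mul_of_one_lt_right Nat.card_pos ((Subgroup.one_lt_card_iff_ne_bot N).2 hN)

/-- **Itô's theorem**, the normality part: a `p`-solvable group all of whose degrees are prime to
`p` has a normal Sylow `p`-subgroup. -/
theorem DegreesPrimeTo.exists_normal_sylow {G : Type} [Group G] [Finite G] {p : ℕ}
    [hp : Fact p.Prime] (hG : DegreesPrimeTo p G) (hs : IsPSolvable p G) :
    ∃ Q : Subgroup G, Q.Normal ∧ IsPGroup p Q ∧ ¬ p ∣ Q.index := by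
  induction hn : Nat.card G using Nat.strong_induction_on generalizing G with
  | _ n ih =>
  rcases subsingleton_or_nontrivial G with hsub | hnt
  · refine ⟨⊥, inferInstance, IsPGroup.of_bot, ?_⟩
    rw [Subgroup.index_bot, Nat.card_unique]
    exact hp.out.one_lt.ne' ∘ Nat.dvd_one.1
  obtain ⟨N, hN, hN0, hpN⟩ := hs.exists_normal
  obtain ⟨Q, hQ, hpQ, hQi⟩ := ih _ (hn ▸ Subgroup.card_quotient_lt hN0) (hG.quotient N)
    (hs.quotient N) rfl
  have hRi : ¬ p ∣ (Q.comap (QuotientGroup.mk' N)).index := by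
    rwa [Subgroup.index_comap_of_surjective _ (QuotientGroup.mk'_surjective N)]
  rcases hpN with hpN | hpN
  · refine ⟨Q.comap (QuotientGroup.mk' N), inferInstance, ?_, hRi⟩
    exact hpQ.comap_of_ker_isPGroup _ (by rwa [QuotientGroup.ker_mk'])
  have hR : ∀ T : Subgroup G, N ≤ T → ¬ p ∣ T.index → Q.comap (QuotientGroup.mk' N) ≤ T := by
    intro T hNT hT
    have h1 : Q ≤ T.map (QuotientGroup.mk' N) := hpQ.normal_le fun h =>
      hT (h.trans (Subgroup.index_map_dvd T (QuotientGroup.mk'_surjective N)))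
    have h2 := Subgroup.comap_mono (f := QuotientGroup.mk' N) h1
    rwa [Subgroup.comap_map_eq, QuotientGroup.ker_mk', sup_eq_left.2 hNT] at h2
  obtain ⟨P⟩ : Nonempty (Sylow p G) := inferInstance
  have hPR : (P : Subgroup G) ≤ Q.comap (QuotientGroup.mk' N) := P.isPGroup'.le_of_normal hRi
  have hcomm : ∀ x ∈ N, ∀ g ∈ (P : Subgroup G), g * x = x * g := fun x hx g hg =>
    P.isPGroup'.commute_of_exists_conj N hpN
      (fun x hx g hg => hG.exists_conj_eq N _ hR hx (hPR hg)) hx hg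
  have hNP : N ≤ Subgroup.normalizer (P : Set G) := fun x hx =>
    Subgroup.centralizer_le_normalizer _ (Subgroup.mem_centralizer_iff.2 (hcomm x hx))
  have hRP := hR _ hNP fun h => P.not_dvd_index
    (h.trans (Subgroup.index_dvd_of_le Subgroup.le_normalizer))
  have := Sylow.normalizer_sup_eq_top' P hPR
  rw [sup_eq_left.2 hRP] at this
  exact ⟨P, Subgroup.normalizer_eq_top_iff.1 this, P.isPGroup', P.not_dvd_index⟩

theorem Representation.isIrreducible_of_finrank_intertwiningMap_eq_one {G V : Type*} [Group G]
    [Finite G] [AddCommGroup V] [Module ℂ V] (ρ : Representation ℂ G V)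
    (h : finrank ℂ (IntertwiningMap ρ ρ) = 1) : ρ.IsIrreducible := by
  rw [isIrreducible_iff_forall_submodule]
  have hid : IntertwiningMap.id ρ ≠ 0 := by
    intro h0
    have hsub : Subsingleton (IntertwiningMap ρ ρ) := by
      refine ⟨fun a b => ?_⟩
      ext v
      have hv : v = 0 := congrArg (fun f : IntertwiningMap ρ ρ => f v) h0
      rw [hv, map_zero, map_zero]
    rw [finrank_zero_of_subsingleton] at h
    exact zero_ne_one h
  have hscalar := (finrank_eq_one_iff_of_nonzero' _ hid).1 h
  constructor
  · by_contra hV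
    rw [not_nontrivial_iff_subsingleton] at hV
    exact hid (by ext v; exact Subsingleton.elim _ _)
  · intro W hW
    obtain ⟨W', hW', hc⟩ := ρ.exists_isCompl_invariant W hW
    have hP : ∀ g v, W.projection W' hc (ρ g v) = ρ g (W.projection W' hc v) := by
      intro g v
      obtain ⟨a, ha, b, hb, rfl⟩ : ∃ a ∈ W, ∃ b ∈ W', a + b = v :=
        Submodule.mem_sup.1 (hc.sup_eq_top ▸ Submodule.mem_top)
      simp only [map_add, Submodule.projection_apply_of_mem_left hc ha,
        Submodule.projection_apply_of_mem_right hc hb,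
        Submodule.projection_apply_of_mem_left hc (hW g a ha),
        Submodule.projection_apply_of_mem_right hc (hW' g b hb), map_zero]
    obtain ⟨c, hcP⟩ := hscalar (LinearMap.intertwiningMap_of_isIntertwiningMap ρ ρ _ hP)
    have hc' : ∀ v, c • v = W.projection W' hc v := fun v =>
      congrArg (fun f : IntertwiningMap ρ ρ => f v) hcP
    by_cases h0 : c = 0
    · left
      refine (Submodule.eq_bot_iff W).2 fun w hw => ?_
      rw [← Submodule.projection_apply_of_mem_left hc hw, ← hc', h0, zero_smul]
    · right
      refine eq_top_iff.2 fun v _ => (Submodule.smul_mem_iff W h0).1 ?_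
      rw [hc']
      exact Submodule.projection_apply_mem hc v

section Characters

variable {G : Type} [Group G] {V W : Type} [AddCommGroup V] [Module ℂ V]
  [FiniteDimensional ℂ V] [AddCommGroup W] [Module ℂ W] [FiniteDimensional ℂ W]

theorem Representation.IsIrreducible.sum_character_mul [Fintype G] {ρ : Representation ℂ G V}
    (hρ : ρ.IsIrreducible) : ∑ g, ρ.character g * ρ.character g⁻¹ = Nat.card G := by
  have hG : (Nat.card G : ℂ) ≠ 0 := by simp
  have := invertibleOfNonzero hG
  have h := char_orthonormal ρ ρ
  rw [if_pos ⟨Equiv.refl ρ⟩] at h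
  exact ((inv_mul_eq_one₀ hG).1 h).symm

theorem Representation.IsIrreducible.nonempty_equiv [Fintype G] {ρ : Representation ℂ G V}
    {σ : Representation ℂ G W} (hρ : ρ.IsIrreducible) (hσ : σ.IsIrreducible)
    (h : ∑ g, ρ.character g * σ.character g⁻¹ ≠ 0) : Nonempty (Equiv σ ρ) := by
  have hG : (Nat.card G : ℂ) ≠ 0 := by simp
  have := invertibleOfNonzero hG
  by_contra hne
  have h1 := char_orthonormal ρ σ
  rw [if_neg hne, mul_eq_zero, inv_eq_zero] at h1
  exact h1.elim hG h

theorem FDRep.simple_iff_isIrreducible [Finite G] (V : FDRep ℂ G) :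
    CategoryTheory.Simple V ↔ Representation.IsIrreducible V.ρ := by
  have := Fintype.ofFinite G
  have hG : (Nat.card G : ℂ) ≠ 0 := by simp
  have := invertibleOfNonzero hG
  rw [FDRep.simple_iff_char_is_norm_one]
  refine ⟨fun h => ?_, fun h => h.sum_character_mul⟩
  have h1 := Representation.card_inv_mul_sum_char_mul_char_eq_finrank V.ρ V.ρ
  apply Representation.isIrreducible_of_finrank_intertwiningMap_eq_one
  have h2 : (Nat.card G : ℂ)⁻¹ * ∑ g, V.character g * V.character g⁻¹ = 1 := by
    rw [h, inv_mul_cancel₀ hG]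
  exact_mod_cast h1.symm.trans h2

end Characters

/-- The irreducible complex characters of `G` whose degree is divisible by `p`. -/
def degreeDvdCharacters (p : ℕ) (G : Type) [Group G] : Set (G → ℂ) :=
  {χ | ∃ (V : Type) (_ : AddCommGroup V) (_ : Module ℂ V) (_ : FiniteDimensional ℂ V)
    (ρ : Representation ℂ G V), ρ.IsIrreducible ∧ ρ.character = χ ∧ p ∣ finrank ℂ V}

theorem npChar_eq_ncard (p : ℕ) (G : Type) [Group G] [Fintype G] :
    npChar p G = (degreeDvdCharacters p G).ncard := by
  refine congrArg (fun s : Set (G → ℂ) => s.ncard) (Set.ext fun χ => ?_)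
  constructor
  · rintro ⟨V, hV, hχ, hp⟩
    exact ⟨V, inferInstance, inferInstance, inferInstance, V.ρ,
      (FDRep.simple_iff_isIrreducible V).1 hV, hχ, hp⟩
  · rintro ⟨V, _, _, _, ρ, hρ, hχ, hp⟩
    exact ⟨FDRep.of ρ, (FDRep.simple_iff_isIrreducible _).2 hρ, hχ, hp⟩

section

variable {G : Type} [Group G] {p : ℕ}

theorem finite_degreeDvdCharacters [Finite G] : (degreeDvdCharacters p G).Finite := by
  have := Fintype.ofFinite G
  have hG : (Nat.card G : ℂ) ≠ 0 := by simp
  have hli : LinearIndepOn ℂ id (degreeDvdCharacters p G) := by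
    refine linearIndependent_iff'.2 fun s c hc i hi => ?_
    have key : ∑ j ∈ s, c j * ∑ g, j.1 g * i.1 g⁻¹ = 0 := by
      have h1 : ∀ g, ∑ j ∈ s, c j * j.1 g = 0 := fun g => by
        simpa [Finset.sum_apply] using congrFun hc g
      simp_rw [Finset.mul_sum]
      rw [Finset.sum_comm]
      refine Finset.sum_eq_zero fun g _ => ?_
      simp_rw [← mul_assoc]
      rw [← Finset.sum_mul, h1, zero_mul]
    obtain ⟨V, _, _, _, ρ, hρ, hχ, -⟩ := i.2
    rw [Finset.sum_eq_single_of_mem i hi] at key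
    · rw [← hχ, hρ.sum_character_mul] at key
      exact (mul_eq_zero.1 key).resolve_right hG
    · intro j _ hji
      obtain ⟨W, _, _, _, σ, hσ, hψ, -⟩ := j.2
      by_contra hne
      rw [← hχ, ← hψ] at hne
      obtain ⟨e⟩ := hσ.nonempty_equiv hρ (right_ne_zero_of_mul hne)
      exact hji (Subtype.ext (by rw [← hχ, ← hψ, char_iso e]))
  exact hli.setFinite

theorem degreesPrimeTo_of_ncard_eq_zero [Finite G] (h : (degreeDvdCharacters p G).ncard = 0) :
    DegreesPrimeTo p G := by
  intro V _ _ _ ρ hρ hp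
  rw [Set.ncard_eq_zero finite_degreeDvdCharacters] at h
  exact Set.notMem_empty ρ.character
    (h ▸ ⟨V, inferInstance, inferInstance, inferInstance, ρ, hρ, rfl, hp⟩)

variable (N : Subgroup G) [N.Normal]

theorem image_degreeDvdCharacters_quotient_subset :
    Set.image (fun χ : G ⧸ N → ℂ => χ ∘ QuotientGroup.mk) (degreeDvdCharacters p (G ⧸ N)) ⊆
      degreeDvdCharacters p G := by
  rintro _ ⟨_, ⟨V, _, _, _, ρ, hρ, rfl, hp⟩, rfl⟩
  exact ⟨V, inferInstance, inferInstance, inferInstance, ρ.comp (QuotientGroup.mk' N),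
    hρ.comp_mk' N, rfl, hp⟩

theorem ncard_image_degreeDvdCharacters_quotient :
    (Set.image (fun χ : G ⧸ N → ℂ => χ ∘ QuotientGroup.mk)
      (degreeDvdCharacters p (G ⧸ N))).ncard = (degreeDvdCharacters p (G ⧸ N)).ncard :=
  Set.ncard_image_of_injective _ (QuotientGroup.mk_surjective.injective_comp_right)

theorem ncard_degreeDvdCharacters_quotient_le [Finite G] :
    (degreeDvdCharacters p (G ⧸ N)).ncard ≤ (degreeDvdCharacters p G).ncard := by
  rw [← ncard_image_degreeDvdCharacters_quotient]
  exact Set.ncard_le_ncard (image_degreeDvdCharacters_quotient_subset N)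
    finite_degreeDvdCharacters

theorem ncard_degreeDvdCharacters_quotient_lt [Finite G] {V : Type} [AddCommGroup V]
    [Module ℂ V] [FiniteDimensional ℂ V] {ρ : Representation ℂ G V} (hρ : ρ.IsIrreducible) {n : G}
    (hn : n ∈ N) (hρn : ρ n ≠ 1) (hp : p ∣ finrank ℂ V) :
    (degreeDvdCharacters p (G ⧸ N)).ncard < (degreeDvdCharacters p G).ncard := by
  have := Fintype.ofFinite G
  rw [← ncard_image_degreeDvdCharacters_quotient]
  refine Set.ncard_lt_ncard ⟨image_degreeDvdCharacters_quotient_subset N, fun hsub => ?_⟩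
    finite_degreeDvdCharacters
  obtain ⟨_, ⟨W, _, _, _, σ, hσ, rfl, -⟩, hχ⟩ :=
    hsub ⟨V, inferInstance, inferInstance, inferInstance, ρ, hρ, rfl, hp⟩
  have hχ' : Representation.character (σ.comp (QuotientGroup.mk' N)) = ρ.character := hχ
  obtain ⟨e⟩ := (hσ.comp_mk' N).nonempty_equiv hρ (by
    rw [hχ', hρ.sum_character_mul]; simp)
  refine hρn (LinearMap.ext fun v => e.toLinearEquiv.injective ?_)
  have h1 : e (ρ n v) = σ (n : G ⧸ N) (e v) := LinearMap.congr_fun (e.toIntertwiningMap.2 n) v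
  rw [(QuotientGroup.eq_one_iff n).2 hn, map_one] at h1
  exact h1

end

theorem derivedSeries_le_ker {A B : Type*} [Group A] [Group B] (f : A →* B) {k : ℕ}
    (hB : derivedSeries B k = ⊥) : derivedSeries A k ≤ f.ker := by
  have := map_derivedSeries_le_derivedSeries f k
  rwa [hB, le_bot_iff, Subgroup.map_eq_bot_iff] at this

theorem derivedSeries_succ_eq_bot {A B : Type*} [Group A] [Group B] (f : A →* B) {k : ℕ}
    (hB : derivedSeries B k = ⊥) (hf : ∀ x ∈ f.ker, ∀ y ∈ f.ker, x * y = y * x) :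
    derivedSeries A (k + 1) = ⊥ := by
  have h := derivedSeries_le_ker f hB
  rw [derivedSeries_succ, Subgroup.commutator_eq_bot_iff_le_centralizer]
  exact fun x hx => Subgroup.mem_centralizer_iff.2 fun y hy => hf y (h hy) x (h hx)

theorem derivedSeries_one_eq_bot {A : Type*} [Group A] (hA : ∀ x y : A, x * y = y * x) :
    derivedSeries A 1 = ⊥ :=
  derivedSeries_succ_eq_bot (1 : A →* Unit) (k := 0) (Subsingleton.elim _ _) fun x _ y _ => hA x y

theorem IsPGroup.eq_one_of_mem_of_not_dvd_card {G : Type*} [Group G] {p : ℕ} [hp : Fact p.Prime]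
    {P N : Subgroup G} (hP : IsPGroup p P) (hN : ¬ p ∣ Nat.card N) {x : G} (hxP : x ∈ P)
    (hxN : x ∈ N) : x = 1 := by
  obtain ⟨k, hk⟩ := hP ⟨x, hxP⟩
  have hk' : x ^ p ^ k = 1 := congrArg Subtype.val hk
  have h1 : orderOf x ∣ p ^ k := orderOf_dvd_of_pow_eq_one hk'
  have h2 : orderOf x ∣ Nat.card N := N.orderOf_dvd_natCard hxN
  exact orderOf_eq_one_iff.1
    (Nat.eq_one_of_dvd_coprimes ((hp.out.coprime_iff_not_dvd.2 hN).pow_left k) h1 h2)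

/-- **Itô's theorem**: in a `p`-solvable group all of whose degrees are prime to `p`, the
`p`-subgroups are abelian. -/
theorem DegreesPrimeTo.commute_of_isPGroup {G : Type} [Group G] [Finite G] {p : ℕ}
    [Fact p.Prime] (hG : DegreesPrimeTo p G) (hs : IsPSolvable p G) {P : Subgroup G}
    (hP : IsPGroup p P) (x y : P) : x * y = y * x := by
  obtain ⟨Q, _, hQ, hQi⟩ := hG.exists_normal_sylow hs
  have hPQ := hP.le_of_normal hQi
  exact Subtype.ext (hG.commute_of_normal Q hQ (hPQ x.2) (hPQ y.2))

theorem derivedSeries_two_eq_bot {G : Type} [Group G] [Finite G] {p : ℕ} [Fact p.Prime]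
    (hs : IsPSolvable p G) {N : Subgroup G} [hN : N.Normal] (hpN : IsPGroup p N)
    (hab : ∀ x ∈ N, ∀ y ∈ N, x * y = y * x) (hne : N ≠ ⊥)
    (h : ∀ (V : Type) [AddCommGroup V] [Module ℂ V] [FiniteDimensional ℂ V]
      (ρ : Representation ℂ G V), ρ.IsIrreducible → (∃ n ∈ N, ρ n ≠ 1) → ¬ p ∣ finrank ℂ V)
    {P : Subgroup G} (hP : IsPGroup p P) : derivedSeries P 2 = ⊥ := by
  obtain ⟨T, hNT, hTi, hT⟩ := exists_degreesPrimeTo_quotient N hpN hab hne h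
  obtain ⟨g, hg⟩ := hP.exists_conj_mem hTi
  let c : P →* T :=
    ((MulAut.conj g⁻¹).toMonoidHom.comp P.subtype).codRestrict T fun x => by
      simpa using hg x x.2
  let f := (QuotientGroup.mk' (N.subgroupOf T)).comp c
  have hker : ∀ x ∈ f.ker, (x : G) ∈ N := by
    intro x hx
    have h1 : g⁻¹ * x * g⁻¹⁻¹ ∈ N := Subgroup.mem_subgroupOf.1 ((QuotientGroup.eq_one_iff _).1 hx)
    simpa [mul_assoc] using hN.conj_mem _ h1 g
  have hrange : IsPGroup p f.range := hP.of_surjective f.rangeRestrict f.rangeRestrict_surjective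
  refine derivedSeries_succ_eq_bot f.rangeRestrict
    (derivedSeries_one_eq_bot (hT.commute_of_isPGroup ((hs.subgroup T).quotient _) hrange)) ?_
  rw [MonoidHom.ker_rangeRestrict]
  exact fun x hx y hy => Subtype.ext (hab x (hker x hx) y (hker y hy))

theorem IsPSolvable.derivedSeries_eq_bot {G : Type} [Group G] [Finite G] {p : ℕ} [Fact p.Prime]
    (hs : IsPSolvable p G) {P : Subgroup G} (hP : IsPGroup p P) :
    derivedSeries P ((degreeDvdCharacters p G).ncard + 1) = ⊥ := by
  induction hn : Nat.card G using Nat.strong_induction_on generalizing G with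
  | _ n ih =>
  rcases subsingleton_or_nontrivial G with hsub | hnt
  · exact Subsingleton.elim _ _
  obtain ⟨N, hN, hN0, hpN⟩ := hs.exists_normal_comm
  have hquot := ih _ (hn ▸ Subgroup.card_quotient_lt hN0) (hs.quotient N)
    (hP.map (QuotientGroup.mk' N)) rfl
  have hker : ∀ x ∈ ((QuotientGroup.mk' N).subgroupMap P).ker, (x : G) ∈ N := fun x hx =>
    (QuotientGroup.eq_one_iff _).1 (congrArg Subtype.val hx)
  rcases hpN with ⟨hpN, hab⟩ | hpN
  · by_cases h : ∀ (V : Type) [AddCommGroup V] [Module ℂ V] [FiniteDimensional ℂ V]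
      (ρ : Representation ℂ G V), ρ.IsIrreducible → (∃ n ∈ N, ρ n ≠ 1) → ¬ p ∣ finrank ℂ V
    · rcases Nat.eq_zero_or_pos (degreeDvdCharacters p G).ncard with h0 | h0
      · rw [h0]
        exact derivedSeries_one_eq_bot
          ((degreesPrimeTo_of_ncard_eq_zero h0).commute_of_isPGroup hs hP)
      · exact le_bot_iff.1 ((derivedSeries_antitone P (Nat.succ_le_succ h0)).trans
          (derivedSeries_two_eq_bot hs hpN hab hN0 h hP).le)
    · push Not at h
      obtain ⟨V, _, _, _, ρ, hρ, ⟨n, hn, hρn⟩, hp⟩ := h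
      have hlt := ncard_degreeDvdCharacters_quotient_lt N hρ hn hρn hp
      refine le_bot_iff.1 ((derivedSeries_antitone P (Nat.succ_le_succ hlt)).trans
        (derivedSeries_succ_eq_bot ((QuotientGroup.mk' N).subgroupMap P) hquot ?_).le)
      exact fun x hx y hy => Subtype.ext (hab x (hker x hx) y (hker y hy))
  · refine le_bot_iff.1 ((derivedSeries_antitone P (Nat.succ_le_succ
      (ncard_degreeDvdCharacters_quotient_le N))).trans fun x hx => ?_)
    have hxker := derivedSeries_le_ker ((QuotientGroup.mk' N).subgroupMap P) hquot hx
    exact Subtype.ext (hP.eq_one_of_mem_of_not_dvd_card hpN x.2 (hker x hxker))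

/-- If `G` is a finite `p`-solvable group and `P` a Sylow `p`-subgroup, then the derived
length of `P` is at most `n_p(G) + 1`. -/
theorem stmt3 {G : Type} [Group G] [Fintype G] {p : ℕ} (hp : p.Prime)
    (hsolv : IsPSolvable p G) (P : Sylow p G) :
    derivedLength ↥(P : Subgroup G) ≤ npChar p G + 1 := by
  have : Fact p.Prime := ⟨hp⟩
  rw [npChar_eq_ncard]
  exact Nat.sInf_le (hsolv.derivedSeries_eq_bot P.isPGroup')
end

section
/- A finite p-subgroup P of GL_n(F), for any field F, has derived length at most ⌊log₂(n)⌋ + 1. -/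
open Module
open scoped commutatorElement

namespace Representation

section Unipotent

variable {F G V : Type*} [Field F] [Group G] [AddCommGroup V] [Module F V]

/-- The ascending series of subspaces whose `(i + 1)`-st term consists of the vectors fixed by `G`
modulo the `i`-th term. -/
def fixedSeries (ρ : Representation F G V) : ℕ → Submodule F V
  | 0 => ⊥
  | i + 1 => ⨅ g, (fixedSeries ρ i).comap (ρ g - 1)

variable (ρ : Representation F G V)

theorem mem_fixedSeries_succ {i : ℕ} {v : V} :
    v ∈ ρ.fixedSeries (i + 1) ↔ ∀ g, ρ g v - v ∈ ρ.fixedSeries i := by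
  simp [fixedSeries]

theorem fixedSeries_le_succ (i : ℕ) : ρ.fixedSeries i ≤ ρ.fixedSeries (i + 1) := by
  induction i with
  | zero => exact bot_le
  | succ i ih =>
    intro v hv
    rw [mem_fixedSeries_succ] at hv ⊢
    exact fun g => ih (hv g)

theorem fixedSeries_mono : Monotone ρ.fixedSeries :=
  monotone_nat_of_le_succ ρ.fixedSeries_le_succ

theorem apply_mem_fixedSeries {i : ℕ} (g : G) {v : V} (hv : v ∈ ρ.fixedSeries i) :
    ρ g v ∈ ρ.fixedSeries i := by
  have h := (ρ.mem_fixedSeries_succ.1 (ρ.fixedSeries_le_succ i hv) g)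
  simpa using add_mem h hv

/-- The subgroup of elements lowering the index in `fixedSeries` by `j`. -/
def depthSubgroup (j : ℕ) : Subgroup G where
  carrier := {g | ∀ i, ∀ v ∈ ρ.fixedSeries (i + j), ρ g v - v ∈ ρ.fixedSeries i}
  one_mem' := by simp
  mul_mem' := by
    intro g h hg hh i v hv
    have := add_mem (ρ.apply_mem_fixedSeries g (hh i v hv)) (hg i v hv)
    simpa using this
  inv_mem' := by
    intro g hg i v hv
    have := neg_mem (ρ.apply_mem_fixedSeries g⁻¹ (hg i v hv))
    simpa using this

theorem commutator_depthSubgroup_le (j k : ℕ) :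
    ⁅ρ.depthSubgroup j, ρ.depthSubgroup k⁆ ≤ ρ.depthSubgroup (j + k) := by
  rw [Subgroup.commutator_le]
  intro g hg h hh i v hv
  obtain ⟨w, rfl⟩ : ∃ w, v = ρ (h * g) w := ⟨ρ (h * g)⁻¹ v, by simp⟩
  have hw : w ∈ ρ.fixedSeries (i + (j + k)) := by
    simpa using ρ.apply_mem_fixedSeries (h * g)⁻¹ hv
  have h1 := hg i _ (hh (i + j) w (by rwa [add_assoc]))
  have h2 := hh i _ (hg (i + k) w (by rwa [add_assoc, add_comm k]))
  have e : ρ ⁅g, h⁆ (ρ (h * g) w) = ρ g (ρ h w) := by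
    rw [← Module.End.mul_apply, ← Module.End.mul_apply, ← map_mul, ← map_mul]
    congr 2
    group
  rw [e]
  convert sub_mem h1 h2 using 1
  simp only [map_sub, map_mul, Module.End.mul_apply]
  abel

theorem derivedSeries_le_depthSubgroup (k : ℕ) : derivedSeries G k ≤ ρ.depthSubgroup (2 ^ k) := by
  induction k with
  | zero => exact fun g _ i v hv => ρ.mem_fixedSeries_succ.1 hv g
  | succ k ih =>
    rw [derivedSeries_succ, pow_succ, mul_two]
    exact (Subgroup.commutator_mono ih ih).trans (ρ.commutator_depthSubgroup_le _ _)

theorem exists_fixed_ne_zero_of_zmodModule {p : ℕ} [Fact p.Prime] [Module (ZMod p) V] [Finite G]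
    (hG : IsPGroup p G) [Nontrivial V] : ∃ v, v ≠ 0 ∧ ∀ g, ρ g v = v := by
  obtain ⟨v, hv⟩ := exists_ne (0 : V)
  let S : Submodule (ZMod p) V := Submodule.span (ZMod p) (Set.range fun g => ρ g v)
  have : FiniteDimensional (ZMod p) S :=
    FiniteDimensional.span_of_finite (ZMod p) (Set.finite_range fun g => ρ g v)
  have : Finite S := Module.finite_of_finite (ZMod p)
  have hS (g : G) (x : V) (hx : x ∈ S) : ρ g x ∈ S := by
    induction hx using Submodule.span_induction with
    | mem x hx =>
      obtain ⟨h, rfl⟩ := hx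
      exact Submodule.subset_span ⟨g * h, by simp⟩
    | zero => simp
    | add x y _ _ hx hy => rw [map_add]; exact add_mem hx hy
    | smul a x _ hx =>
      have := ZMod.map_smul (ρ g : V →+ V) a x
      rw [AddMonoidHom.coe_coe] at this
      rw [this]
      exact S.smul_mem a hx
  let _ : MulAction G S :=
    { smul := fun g x => ⟨ρ g x, hS g x x.2⟩
      one_smul := fun x => Subtype.ext (by change ρ 1 (x : V) = x; simp)
      mul_smul := fun g h x => Subtype.ext
        (by change ρ (g * h) (x : V) = ρ g (ρ h x); simp) }
  have hvS : v ∈ S := Submodule.subset_span ⟨1, by simp⟩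
  have hcard : p ∣ Nat.card S := by
    have : addOrderOf (⟨v, hvS⟩ : S) = p :=
      addOrderOf_eq_prime (Subtype.ext (ZModModule.char_nsmul_eq_zero p v))
        fun h => hv (congrArg Subtype.val h)
    exact this.symm.dvd.trans (addOrderOf_dvd_natCard _)
  obtain ⟨w, hw, hw0⟩ := hG.exists_fixed_point_of_prime_dvd_card_of_fixed_point S hcard
    (a := 0) (fun g => Subtype.ext (map_zero (ρ g)))
  exact ⟨w, fun h => hw0 (Subtype.ext h.symm), fun g => congrArg Subtype.val (hw g)⟩

theorem exists_fixed_ne_zero {p : ℕ} [Fact p.Prime] [CharP F p] [Finite G] (hG : IsPGroup p G)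
    [Nontrivial V] : ∃ v, v ≠ 0 ∧ ∀ g, ρ g v = v := by
  let _ : Module (ZMod p) V := AddCommGroup.zmodModule fun x => by
    rw [← Nat.cast_smul_eq_nsmul F, CharP.cast_eq_zero, zero_smul]
  exact ρ.exists_fixed_ne_zero_of_zmodModule hG

theorem fixedSeries_lt_succ {p : ℕ} [Fact p.Prime] [CharP F p] [Finite G] (hG : IsPGroup p G)
    {i : ℕ} (hi : ρ.fixedSeries i ≠ ⊤) : ρ.fixedSeries i < ρ.fixedSeries (i + 1) := by
  have : Nontrivial (V ⧸ ρ.fixedSeries i) := Submodule.Quotient.nontrivial_iff.2 hi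
  obtain ⟨x, hx0, hx⟩ := (ρ.quotient (ρ.fixedSeries i)
    fun g v hv => ρ.apply_mem_fixedSeries g hv).exists_fixed_ne_zero hG
  obtain ⟨v, rfl⟩ := Submodule.Quotient.mk_surjective _ x
  refine lt_of_le_not_ge (ρ.fixedSeries_le_succ i) fun h => hx0 ?_
  rw [Submodule.Quotient.mk_eq_zero]
  refine h (ρ.mem_fixedSeries_succ.2 fun g => ?_)
  rw [← Submodule.Quotient.eq]
  exact hx g

theorem fixedSeries_eq_top {p : ℕ} [Fact p.Prime] [CharP F p] [Finite G] (hG : IsPGroup p G)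
    [FiniteDimensional F V] : ρ.fixedSeries (finrank F V) = ⊤ := by
  have key (i : ℕ) : ρ.fixedSeries i = ⊤ ∨ i ≤ finrank F (ρ.fixedSeries i) := by
    induction i with
    | zero => exact Or.inr (Nat.zero_le _)
    | succ i ih =>
      by_cases hi : ρ.fixedSeries i = ⊤
      · exact Or.inl (top_le_iff.1 (hi ▸ ρ.fixedSeries_le_succ i))
      · exact Or.inr ((ih.resolve_left hi).trans_lt
          (Submodule.finrank_lt_finrank_of_lt (ρ.fixedSeries_lt_succ hG hi)))
  refine (key _).elim id fun h => Submodule.eq_top_of_finrank_eq ?_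
  exact le_antisymm (Submodule.finrank_le _) h

/-- A finite `p`-group acting in characteristic `p` on a space of dimension less than `2 ^ k` has
trivially acting `k`-th derived subgroup. -/
theorem eq_one_of_mem_derivedSeries_of_charP {p : ℕ} [Fact p.Prime] [CharP F p] [Finite G]
    (hG : IsPGroup p G) [FiniteDimensional F V] {k : ℕ} (hk : finrank F V < 2 ^ k) {g : G}
    (hg : g ∈ derivedSeries G k) : ρ g = 1 := by
  ext v
  have hv : v ∈ ρ.fixedSeries (0 + 2 ^ k) :=
    ρ.fixedSeries_mono (by omega) (ρ.fixedSeries_eq_top hG ▸ Submodule.mem_top)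
  exact sub_eq_zero.1 (ρ.derivedSeries_le_depthSubgroup k hg 0 v hv)

end Unipotent

section Semisimple

variable {K G V : Type*} [Field K] [Group G] [AddCommGroup V] [Module K V]

/-- The subgroup of elements acting by scalars. -/
def scalarSubgroup (ρ : Representation K G V) : Subgroup G where
  carrier := {g | ∃ c : K, ρ g = c • 1}
  one_mem' := ⟨1, by simp⟩
  mul_mem' := by
    rintro g h ⟨c, hc⟩ ⟨d, hd⟩
    exact ⟨c * d, by rw [map_mul, hc, hd, smul_mul_smul_comm, one_mul]⟩
  inv_mem' := by
    rintro g ⟨c, hc⟩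
    by_cases h : c = 0
    · refine ⟨0, ?_⟩
      have : ρ g⁻¹ * ρ g = 1 := by rw [← map_mul]; simp
      rw [hc, h, zero_smul, mul_zero] at this
      rw [zero_smul, ← mul_one (ρ g⁻¹), ← this, mul_zero]
    · refine ⟨c⁻¹, ?_⟩
      have : ρ g⁻¹ * ρ g = 1 := by rw [← map_mul]; simp
      rw [hc, mul_smul_comm, mul_one] at this
      rw [← this, smul_smul, inv_mul_cancel₀ h, one_smul]

variable (ρ : Representation K G V)

instance : ρ.scalarSubgroup.Normal where
  conj_mem := by
    rintro g ⟨c, hc⟩ h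
    refine ⟨c, ?_⟩
    rw [map_mul, map_mul, hc, mul_smul_comm, mul_one, smul_mul_assoc, ← map_mul]
    simp

theorem exists_notMem_scalarSubgroup {p : ℕ} [Fact p.Prime] [Finite G] (hG : IsPGroup p G)
    (h : ρ.scalarSubgroup ≠ ⊤) :
    ∃ x ∉ ρ.scalarSubgroup, ∀ g, ∃ c : K, ρ x * ρ g = c • (ρ g * ρ x) := by
  have : Nontrivial (G ⧸ ρ.scalarSubgroup) := QuotientGroup.nontrivial_iff.2 h
  have := (hG.to_quotient ρ.scalarSubgroup).center_nontrivial
  obtain ⟨⟨z, hz⟩, hz1⟩ := exists_ne (1 : Subgroup.center (G ⧸ ρ.scalarSubgroup))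
  obtain ⟨x, rfl⟩ := QuotientGroup.mk_surjective z
  refine ⟨x, fun hx => hz1 (Subtype.ext ((QuotientGroup.eq_one_iff x).2 hx)), fun g => ?_⟩
  have := Subgroup.mem_center_iff.1 hz g
  rw [← QuotientGroup.mk_mul, ← QuotientGroup.mk_mul, QuotientGroup.eq] at this
  obtain ⟨c, hc⟩ := this
  refine ⟨c, ?_⟩
  have e : x * g = (g * x) * ((g * x)⁻¹ * (x * g)) := by group
  rw [← map_mul, e, map_mul, hc, mul_smul_comm, mul_one, map_mul]

variable {ρ}

theorem commute_of_mem_commutator {x : G} (hx : ∀ g, ∃ c : K, ρ x * ρ g = c • (ρ g * ρ x)) {g : G}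
    (hg : g ∈ commutator G) : ρ x * ρ g = ρ g * ρ x := by
  let C : Subgroup G := (Subgroup.centralizer {ρ.toHomUnits x}).comap ρ.toHomUnits
  have hC (g : G) : g ∈ C ↔ ρ x * ρ g = ρ g * ρ x := by
    rw [Subgroup.mem_comap, Subgroup.mem_centralizer_singleton_iff, eq_comm, Units.ext_iff]
    rfl
  rw [← hC]
  refine (Subgroup.commutator_le (H₃ := C)).2 (fun a _ b _ => ?_) hg
  obtain ⟨c, hc⟩ := hx a
  obtain ⟨d, hd⟩ := hx b
  rw [hC]
  have h1 : ρ x * ρ (a * b) = (c * d) • (ρ (a * b) * ρ x) := by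
    rw [map_mul, ← mul_assoc, hc, smul_mul_assoc, mul_assoc, hd, mul_smul_comm, smul_smul,
      mul_assoc]
  have h2 : ρ x * ρ (b * a) = (c * d) • (ρ (b * a) * ρ x) := by
    rw [map_mul, ← mul_assoc, hd, smul_mul_assoc, mul_assoc, hc, mul_smul_comm, smul_smul,
      mul_assoc, mul_comm d]
  have e : a * b = ⁅a, b⁆ * (b * a) := by group
  have hu : ρ (b * a) * ρ (b * a)⁻¹ = 1 := by rw [← map_mul]; simp
  rw [e, map_mul, mul_assoc, ← mul_smul_comm, ← h2, ← mul_assoc, ← mul_assoc] at h1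
  simpa only [mul_assoc, hu, mul_one] using congrArg (· * ρ (b * a)⁻¹) h1

theorem apply_mem_eigenspace {x g : G} {c μ : K} (h : ρ x * ρ g = c • (ρ g * ρ x)) {v : V}
    (hv : v ∈ End.eigenspace (ρ x) μ) : ρ g v ∈ End.eigenspace (ρ x) (c * μ) := by
  rw [End.mem_eigenspace_iff] at hv ⊢
  have := LinearMap.congr_fun h v
  simpa [hv, smul_smul] using this

theorem iSup_eigenspace_eq_top [IsAlgClosed K] [FiniteDimensional K V] [ρ.IsIrreducible] {x : G}
    [Nontrivial V] (hx : ∀ g, ∃ c : K, ρ x * ρ g = c • (ρ g * ρ x)) :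
    ⨆ μ, End.eigenspace (ρ x) μ = ⊤ := by
  let W : Subrepresentation ρ :=
    { toSubmodule := ⨆ μ, End.eigenspace (ρ x) μ
      apply_mem_toSubmodule := by
        intro g
        obtain ⟨c, hc⟩ := hx g
        change (⨆ μ, End.eigenspace (ρ x) μ) ≤ (⨆ μ, End.eigenspace (ρ x) μ).comap (ρ g)
        exact iSup_le fun μ v hv => Submodule.mem_iSup_of_mem _ (apply_mem_eigenspace hc hv) }
  obtain ⟨μ, hμ⟩ := End.exists_eigenvalue (ρ x)
  rcases eq_bot_or_eq_top W with h | h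
  · exact absurd (le_bot_iff.1 ((le_iSup _ μ).trans
      (congrArg Subrepresentation.toSubmodule h).le)) hμ
  · exact congrArg Subrepresentation.toSubmodule h

theorem two_mul_finrank_eigenspace_le [FiniteDimensional K V] [ρ.IsIrreducible] {x : G}
    (hx : ∀ g, ∃ c : K, ρ x * ρ g = c • (ρ g * ρ x)) (hxs : x ∉ ρ.scalarSubgroup) (μ : K) :
    2 * finrank K (End.eigenspace (ρ x) μ) ≤ finrank K V := by
  by_cases hμ : End.eigenspace (ρ x) μ = ⊥
  · rw [hμ, finrank_bot]
    exact Nat.zero_le _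
  have hμ0 : μ ≠ 0 := by
    rintro rfl
    refine hμ ?_
    rw [End.eigenspace_zero, LinearMap.ker_eq_bot]
    exact (ρ.apply_bijective x).1
  obtain ⟨g, c, hc1, hc⟩ : ∃ g, ∃ c : K, c ≠ 1 ∧ ρ x * ρ g = c • (ρ g * ρ x) := by
    by_contra! hcon
    let W : Subrepresentation ρ :=
      { toSubmodule := End.eigenspace (ρ x) μ
        apply_mem_toSubmodule := by
          intro g v hv
          obtain ⟨c, hc⟩ := hx g
          obtain rfl : c = 1 := by_contra fun h => hcon g c h hc
          simpa using apply_mem_eigenspace hc hv }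
    rcases eq_bot_or_eq_top W with h | h
    · exact hμ (congrArg Subrepresentation.toSubmodule h)
    · refine hxs ⟨μ, LinearMap.ext fun v => ?_⟩
      have : v ∈ End.eigenspace (ρ x) μ :=
        (congrArg Subrepresentation.toSubmodule h).ge Submodule.mem_top
      simpa using End.mem_eigenspace_iff.1 this
  have hdisj : Disjoint (End.eigenspace (ρ x) μ) (End.eigenspace (ρ x) (c * μ)) :=
    (End.eigenspaces_iSupIndep (ρ x)).pairwiseDisjoint fun h => hc1 (mul_right_cancel₀ hμ0
      (by rw [← h, one_mul]))
  have hle : finrank K (End.eigenspace (ρ x) μ) ≤ finrank K (End.eigenspace (ρ x) (c * μ)) :=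
    LinearMap.finrank_le_finrank_of_injective
      (f := (ρ g).restrict fun v hv => apply_mem_eigenspace hc hv)
      fun v w h => Subtype.ext ((ρ.apply_bijective g).1 (congrArg Subtype.val h))
  have := Submodule.finrank_add_finrank_le_of_disjoint hdisj
  omega

end Semisimple

end Representation

theorem map_subtype_derivedSeries_commutator (G : Type*) [Group G] (k : ℕ) :
    (derivedSeries (commutator G) k).map (commutator G).subtype = derivedSeries G (k + 1) := by
  induction k with
  | zero => rw [derivedSeries_zero, ← MonoidHom.range_eq_map, Subgroup.range_subtype,
      derivedSeries_one]
  | succ k ih => rw [derivedSeries_succ, Subgroup.map_commutator, ih, ← derivedSeries_succ]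

namespace Representation

universe u v w

/-- A finite `p`-group acting on a space of dimension less than `2 ^ k` over an algebraically closed
field of characteristic other than `p` has trivially acting `k`-th derived subgroup. -/
theorem eq_one_of_mem_derivedSeries_of_natCast_ne_zero {K : Type u} [Field K] [IsAlgClosed K]
    {p : ℕ} [Fact p.Prime] (hpK : (p : K) ≠ 0) (k : ℕ) {G : Type v} [Group G] [Finite G]
    (hG : IsPGroup p G) {V : Type w} [AddCommGroup V] [Module K V] [FiniteDimensional K V]
    (ρ : Representation K G V) (hk : finrank K V < 2 ^ k) {g : G} (hg : g ∈ derivedSeries G k) :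
    ρ g = 1 := by
  induction k generalizing G V with
  | zero =>
    have : Subsingleton V := finrank_zero_iff.1 (by simpa using hk)
    exact Subsingleton.elim _ _
  | succ k ihk =>
    induction hn : finrank K V using Nat.strong_induction_on generalizing V with
    | _ n ihn =>
    subst hn
    rcases subsingleton_or_nontrivial V with _ | _
    · exact Subsingleton.elim _ _
    have : NeZero (Nat.card G : K) := by
      obtain ⟨m, hm⟩ := IsPGroup.iff_card.1 hG
      exact ⟨by rw [hm, Nat.cast_pow]; exact pow_ne_zero _ hpK⟩
    by_cases hirr : ρ.IsIrreducible
    · by_cases hs : ρ.scalarSubgroup = ⊤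
      · have hle : derivedSeries G (k + 1) ≤ ρ.toHomUnits.ker := by
          refine (derivedSeries_antitone G (Nat.le_add_left 1 k)).trans ?_
          rw [derivedSeries_one, commutator_def, Subgroup.commutator_le]
          intro a _ b _
          obtain ⟨c, hc⟩ := hs.ge (Subgroup.mem_top a)
          rw [MonoidHom.mem_ker, map_commutatorElement, commutatorElement_eq_one_iff_mul_comm]
          ext1
          simp [hc]
        simpa [Units.ext_iff] using MonoidHom.mem_ker.1 (hle hg)
      · obtain ⟨x, hxs, hx⟩ := ρ.exists_notMem_scalarSubgroup hG hs
        rw [← map_subtype_derivedSeries_commutator] at hg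
        obtain ⟨g, hg, rfl⟩ := hg
        rw [← sub_eq_zero, ← LinearMap.ker_eq_top, ← top_le_iff, ← iSup_eigenspace_eq_top hx]
        refine iSup_le fun μ v hv => ?_
        let W : Subrepresentation (ρ.comp (commutator G).subtype) :=
          { toSubmodule := End.eigenspace (ρ x) μ
            apply_mem_toSubmodule := fun g v hv => by
              have h := commute_of_mem_commutator hx g.2
              rw [← one_smul K (ρ g * ρ x)] at h
              simpa using apply_mem_eigenspace h hv }
        have hW : finrank K W.toSubmodule < 2 ^ k := by
          have := two_mul_finrank_eigenspace_le hx hxs μ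
          change finrank K (End.eigenspace (ρ x) μ) < 2 ^ k
          omega
        have := LinearMap.congr_fun (ihk (hG.to_subgroup _) W.toRepresentation hW hg) ⟨v, hv⟩
        rw [LinearMap.mem_ker, LinearMap.sub_apply, sub_eq_zero]
        exact congrArg Subtype.val this
    · have : Nontrivial (Subrepresentation ρ) :=
        ⟨⊥, ⊤, fun h => bot_ne_top (congrArg Subrepresentation.toSubmodule h)⟩
      obtain ⟨W, hW0, hW1⟩ : ∃ W : Subrepresentation ρ, W ≠ ⊥ ∧ W ≠ ⊤ := by
        by_contra! hcon
        exact hirr ⟨fun W => or_iff_not_imp_left.2 (hcon W)⟩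
      obtain ⟨U, hU⟩ := exists_isCompl W
      have hU1 : U ≠ ⊤ := by
        rintro rfl
        exact hW0 (by simpa using hU.inf_eq_bot)
      have key (X : Subrepresentation ρ) (hX : X ≠ ⊤) :
          X.toSubmodule ≤ LinearMap.ker (ρ g - 1) := by
        intro v hv
        have hlt : finrank K X.toSubmodule < finrank K V :=
          Submodule.finrank_lt fun h => hX (Subrepresentation.toSubmodule_injective h)
        have := LinearMap.congr_fun (ihn _ hlt X.toRepresentation (hlt.trans hk) rfl) ⟨v, hv⟩
        rw [LinearMap.mem_ker, LinearMap.sub_apply, sub_eq_zero]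
        exact congrArg Subtype.val this
      rw [← sub_eq_zero, ← LinearMap.ker_eq_top, ← top_le_iff]
      exact (congrArg Subrepresentation.toSubmodule hU.sup_eq_top).ge.trans
        (sup_le (key W hW1) (key U hU1))

end Representation

/-- A finite `p`-subgroup `P` of `GL_n(F)`, for any field `F`, has derived length at most
`⌊log₂ n⌋ + 1`. -/
theorem stmt7 {F : Type*} [Field F] {n p : ℕ} (hp : p.Prime)
    (P : Subgroup (GL (Fin n) F)) [Finite ↥P] (hP : IsPGroup p ↥P) :
    derivedLength ↥P ≤ Nat.log 2 n + 1 := by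
  have : Fact p.Prime := ⟨hp⟩
  refine Nat.sInf_le ((Subgroup.eq_bot_iff_forall _).2 fun g hg => ?_)
  by_cases hpF : (p : F) = 0
  · have : CharP F p := (CharP.charP_iff_prime_eq_zero hp).2 hpF
    let ρ : Representation F P (Fin n → F) :=
      ((Matrix.toLinAlgEquiv' : Matrix (Fin n) (Fin n) F ≃ₐ[F] _) : _ →* _).comp
        ((Units.coeHom _).comp P.subtype)
    have h := ρ.eq_one_of_mem_derivedSeries_of_charP hP
      (by simpa using Nat.lt_pow_succ_log_self one_lt_two n) hg
    have h' := (EmbeddingLike.map_eq_one_iff (f := Matrix.toLinAlgEquiv')).1 h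
    exact Subtype.ext (Units.ext h')
  · let K := AlgebraicClosure F
    let ρ : Representation K P (Fin n → K) :=
      ((Matrix.toLinAlgEquiv' : Matrix (Fin n) (Fin n) K ≃ₐ[K] _) : _ →* _).comp
        ((((algebraMap F K).mapMatrix : Matrix (Fin n) (Fin n) F →+* Matrix (Fin n) (Fin n) K) :
          Matrix (Fin n) (Fin n) F →* Matrix (Fin n) (Fin n) K).comp
          ((Units.coeHom _).comp P.subtype))
    have hpK : (p : K) ≠ 0 := by
      rw [← map_natCast (algebraMap F K)]
      exact (map_ne_zero _).2 hpF
    have h := ρ.eq_one_of_mem_derivedSeries_of_natCast_ne_zero hpK (Nat.log 2 n + 1) hP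
      (by simpa using Nat.lt_pow_succ_log_self one_lt_two n) hg
    have h' := (EmbeddingLike.map_eq_one_iff (f := Matrix.toLinAlgEquiv')).1 h
    refine Subtype.ext (Units.ext (Matrix.map_injective (algebraMap F K).injective ?_))
    exact h'.trans (by simp)
end

section
/- For every integer n ≥ 6, the number of partitions p(n) satisfies p(n) > e^{2√n}/14, and consequently p(n)/2 ≥ log₂(n) + 2. -/
open Finset

/-- Adding `l` copies of a positive integer `m` to a partition of `n - m * l`. -/
theorem Nat.Partition.card_le_card_le_count {n m l : ℕ} (hm : 0 < m) (h : m * l ≤ n) :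
    Fintype.card (Nat.Partition (n - m * l)) ≤
      #{π : Nat.Partition n | l ≤ π.parts.count m} := by
  rw [← Finset.card_univ]
  refine Finset.card_le_card_of_injOn
    (fun π => ⟨Multiset.replicate l m + π.parts, fun {i} hi => ?_, ?_⟩) ?_ ?_
  · rcases Multiset.mem_add.1 hi with hi | hi
    · rwa [Multiset.eq_of_mem_replicate hi]
    · exact π.parts_pos hi
  · rw [Multiset.sum_add, π.parts_sum, Multiset.sum_replicate, smul_eq_mul, mul_comm l]
    omega
  · intro π _
    simp
  · intro π _ ρ _ hπρ
    exact Nat.Partition.ext (add_left_cancel (congrArg Nat.Partition.parts hπρ))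

theorem Nat.Partition.sum_count_mul {n : ℕ} (π : Nat.Partition n) :
    ∑ m ∈ Icc 1 n, π.parts.count m * m = n := by
  conv_rhs => rw [← π.parts_sum, Finset.sum_multiset_count]
  simp only [smul_eq_mul]
  refine (Finset.sum_subset (fun i hi => ?_) fun i _ hi => ?_).symm
  · rw [Multiset.mem_toFinset] at hi
    exact Finset.mem_Icc.2 ⟨π.parts_pos hi, π.le_of_mem_parts hi⟩
  · rw [Multiset.mem_toFinset] at hi
    simp [Multiset.count_eq_zero_of_notMem hi]

/-- Counting the total size of all partitions of `n` by the multiplicities of their parts. -/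
theorem Nat.Partition.sum_divisors_mul_card_le (n : ℕ) :
    ∑ k ∈ Icc 1 n, (∑ m ∈ k.divisors, m) * Fintype.card (Nat.Partition (n - k)) ≤
      n * Fintype.card (Nat.Partition n) := by
  have hcount (m : ℕ) (π : Nat.Partition n) :
      #{k ∈ Icc 1 n | m ∣ k ∧ k / m ≤ π.parts.count m} ≤ π.parts.count m := by
    calc _ ≤ #(Icc 1 (π.parts.count m)) := by
          refine Finset.card_le_card_of_injOn (· / m) (fun k hk => ?_) fun k hk j hj hkj => ?_
          · simp only [Finset.coe_filter, Finset.mem_Icc, Set.mem_ofPred_eq] at hk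
            simp only [Finset.coe_Icc, Set.mem_Icc]
            exact ⟨Nat.div_pos (Nat.le_of_dvd hk.1.1 hk.2.1) (Nat.pos_of_dvd_of_pos hk.2.1 hk.1.1),
              hk.2.2⟩
          · simp only [Finset.coe_filter, Finset.mem_Icc, Set.mem_ofPred_eq] at hk hj
            exact (Nat.div_left_inj hk.2.1 hj.2.1).1 hkj
      _ = _ := by simp
  calc
    _ ≤ ∑ k ∈ Icc 1 n, ∑ m ∈ Icc 1 n,
        ∑ π : Nat.Partition n, (if m ∣ k ∧ k / m ≤ π.parts.count m then m else 0) := by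
      refine Finset.sum_le_sum fun k hk => ?_
      rw [Finset.mem_Icc] at hk
      rw [Finset.sum_mul]
      calc _ ≤ ∑ m ∈ k.divisors,
          ∑ π : Nat.Partition n, (if m ∣ k ∧ k / m ≤ π.parts.count m then m else 0) := by
            refine Finset.sum_le_sum fun m hm => ?_
            obtain ⟨l, rfl⟩ := Nat.dvd_of_mem_divisors hm
            have hm0 : 0 < m := Nat.pos_of_mem_divisors hm
            simp only [dvd_mul_right, true_and, Nat.mul_div_cancel_left l hm0]
            rw [← Finset.sum_filter, Finset.sum_const, smul_eq_mul, mul_comm]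
            exact Nat.mul_le_mul_right _ (card_le_card_le_count hm0 hk.2)
        _ ≤ _ := Finset.sum_le_sum_of_subset fun m hm => Finset.mem_Icc.2
            ⟨Nat.pos_of_mem_divisors hm, (Nat.divisor_le hm).trans hk.2⟩
    _ = ∑ π : Nat.Partition n, ∑ m ∈ Icc 1 n,
        #{k ∈ Icc 1 n | m ∣ k ∧ k / m ≤ π.parts.count m} * m := by
      rw [Finset.sum_comm, Finset.sum_comm (s := univ)]
      refine Finset.sum_congr rfl fun m _ => ?_
      rw [Finset.sum_comm]
      refine Finset.sum_congr rfl fun π _ => ?_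
      rw [← Finset.sum_filter, Finset.sum_const, smul_eq_mul]
    _ ≤ ∑ π : Nat.Partition n, ∑ m ∈ Icc 1 n, π.parts.count m * m :=
      Finset.sum_le_sum fun π _ => Finset.sum_le_sum fun m _ =>
        Nat.mul_le_mul_right _ (hcount m π)
    _ = n * Fintype.card (Nat.Partition n) := by
      simp only [sum_count_mul, Finset.sum_const, Finset.card_univ, smul_eq_mul]
      exact mul_comm _ _

/-- The numbers of partitions of `168, 167, …, 1, 0`. -/
def partitionTable : List ℕ :=
  [228204732751, 207890420102, 189334822579, 172389800255, 156919475295, 142798995930,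
    129913904637, 118159068427, 107438159466, 97662728555, 88751778802, 80630964769, 73232243759,
    66493182097, 60356673280, 54770336324, 49686288421, 45060624582, 40853235313, 37027355200,
    33549419497, 30388671978, 27517052599, 24908858009, 22540654445, 20390982757, 18440293320,
    16670689208, 15065878135, 13610949895, 12292341831, 11097645016, 10015581680, 9035836076,
    8149040695, 7346629512, 6620830889, 5964539504, 5371315400, 4835271870, 4351078600, 3913864295,
    3519222692, 3163127352, 2841940500, 2552338241, 2291320912, 2056148051, 1844349560, 1653668665,
    1482074143, 1327710076, 1188908248, 1064144451, 952050665, 851376628, 761002156, 679903203,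
    607163746, 541946240, 483502844, 431149389, 384276336, 342325709, 304801365, 271248950,
    241265379, 214481126, 190569292, 169229875, 150198136, 133230930, 118114304, 104651419,
    92669720, 82010177, 72533807, 64112359, 56634173, 49995925, 44108109, 38887673, 34262962,
    30167357, 26543660, 23338469, 20506255, 18004327, 15796476, 13848650, 12132164, 10619863,
    9289091, 8118264, 7089500, 6185689, 5392783, 4697205, 4087968, 3554345, 3087735, 2679689,
    2323520, 2012558, 1741630, 1505499, 1300156, 1121505, 966467, 831820, 715220, 614154, 526823,
    451276, 386155, 329931, 281589, 239943, 204226, 173525, 147273, 124754, 105558, 89134, 75175,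
    63261, 53174, 44583, 37338, 31185, 26015, 21637, 17977, 14883, 12310, 10143, 8349, 6842, 5604,
    4565, 3718, 3010, 2436, 1958, 1575, 1255, 1002, 792, 627, 490, 385, 297, 231, 176, 135, 101,
    77, 56, 42, 30, 22, 15, 11, 7, 5, 3, 2, 1, 1]

/-- The sum `σ(k) a₀ + σ(k + 1) a₁ + ⋯` for the list `[a₀, a₁, …]`. -/
def sigmaConvolution : ℕ → List ℕ → ℕ
  | _, [] => 0
  | k, a :: L => (∑ m ∈ k.divisors, m) * a + sigmaConvolution (k + 1) L

/-- The list, read backwards, is a sequence that satisfies the recurrence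
`n p(n) = ∑ σ(k) p(n - k)` of the partition numbers with `≤` in place of `=`. -/
def SatisfiesRecurrence : List ℕ → Prop
  | [] => True
  | a :: L => (L.length * a ≤ sigmaConvolution 1 L ∧ (L.length = 0 → a ≤ 1)) ∧
      SatisfiesRecurrence L

instance decidableSatisfiesRecurrence : ∀ L, Decidable (SatisfiesRecurrence L)
  | [] => inferInstanceAs (Decidable True)
  | a :: L =>
    letI := decidableSatisfiesRecurrence L
    inferInstanceAs (Decidable ((_ ∧ (L.length = 0 → a ≤ 1)) ∧ SatisfiesRecurrence L))

theorem sigmaConvolution_eq_sum (k : ℕ) (L : List ℕ) :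
    sigmaConvolution k L = ∑ j ∈ range L.length, (∑ m ∈ (k + j).divisors, m) * L.getD j 0 := by
  induction L generalizing k with
  | nil => rfl
  | cons a L ih =>
    rw [sigmaConvolution, ih, List.length_cons, Finset.sum_range_succ', add_comm]
    simp [Nat.add_right_comm k _ 1, ← Nat.add_assoc]

theorem SatisfiesRecurrence.getD_le_card {L : List ℕ} (h : SatisfiesRecurrence L) :
    ∀ i < L.length, L.getD i 0 ≤ Fintype.card (Nat.Partition (L.length - 1 - i)) := by
  induction L with
  | nil => simp
  | cons a L ih =>
    obtain ⟨⟨hrec, hnil⟩, hL⟩ := h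
    intro i hi
    rcases i with _ | i
    · simp only [List.getD_cons_zero, List.length_cons, Nat.add_sub_cancel, Nat.sub_zero]
      rcases Nat.eq_zero_or_pos L.length with h0 | h0
      · exact (hnil h0).trans (Fintype.card_pos (α := Nat.Partition L.length))
      refine Nat.le_of_mul_le_mul_left (hrec.trans ?_) h0
      refine le_trans ?_ (Nat.Partition.sum_divisors_mul_card_le L.length)
      rw [sigmaConvolution_eq_sum, ← Finset.Ico_add_one_right_eq_Icc,
        Finset.sum_Ico_eq_sum_range, Nat.add_sub_cancel]
      refine Finset.sum_le_sum fun j hj => Nat.mul_le_mul_left _ ?_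
      rw [← Nat.sub_sub]
      exact ih hL j (Finset.mem_range.1 hj)
    · have := ih hL i (by simpa using hi)
      simpa [Nat.sub_sub, add_comm] using this

theorem satisfiesRecurrence_partitionTable : SatisfiesRecurrence partitionTable := by
  decide +kernel

theorem partitionTable_getD_le_card {n : ℕ} (hn : n < 169) :
    partitionTable.getD (168 - n) 0 ≤ Fintype.card (Nat.Partition n) := by
  have hlen : partitionTable.length = 169 := rfl
  have := satisfiesRecurrence_partitionTable.getD_le_card (168 - n) (by omega)
  rwa [hlen, show 169 - 1 - (168 - n) = n by omega] at this

/-- A rational certificate for an upper bound of `exp (2 * √n)`, where `r / 200` exceeds `√n`. -/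
theorem Real.exp_two_mul_sqrt_lt {n a r : ℕ} (hr : 40000 * n ≤ r ^ 2)
    (h : 27182818286 ^ (2 * r) < a ^ 200 * 10000000000 ^ (2 * r)) :
    Real.exp (2 * √n) < a := by
  have hsqrt : 200 * √n ≤ r := by
    rw [← Real.sqrt_sq (Nat.cast_nonneg (α := ℝ) r),
      show (200 : ℝ) = √40000 by rw [show (40000 : ℝ) = 200 ^ 2 by norm_num]; simp,
      ← Real.sqrt_mul (by norm_num)]
    exact Real.sqrt_le_sqrt (by exact_mod_cast hr)
  refine lt_of_pow_lt_pow_left₀ 200 (Nat.cast_nonneg a) ?_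
  calc Real.exp (2 * √n) ^ 200 = Real.exp (2 * (200 * √n)) := by
        rw [← Real.exp_nat_mul]; congr 1; push_cast; ring
    _ ≤ Real.exp (2 * r) := Real.exp_le_exp.2 (by linarith)
    _ = Real.exp 1 ^ (2 * r) := by rw [← Real.exp_nat_mul]; congr 1; push_cast; ring
    _ ≤ (27182818286 / 10000000000) ^ (2 * r) := by
        gcongr
        exact Real.exp_one_lt_d9.le.trans (by norm_num)
    _ < (a : ℝ) ^ 200 := by
        rw [div_pow, div_lt_iff₀ (by positivity)]
        exact_mod_cast h

theorem partitionTable_spec : ∀ n < 169,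
    27182818286 ^ (2 * (Nat.sqrt (40000 * n) + 1)) <
      (14 * partitionTable.getD (168 - n) 0) ^ 200 *
        10000000000 ^ (2 * (Nat.sqrt (40000 * n) + 1)) ∧
    (6 ≤ n → n + 4 ≤ partitionTable.getD (168 - n) 0) := by
  decide +kernel

theorem exp_lt_card_of_lt {n : ℕ} (hn : n < 169) :
    Real.exp (2 * √n) < 14 * (Fintype.card (Nat.Partition n) : ℝ) := by
  have h := Real.exp_two_mul_sqrt_lt (Nat.lt_succ_sqrt' (40000 * n)).le (partitionTable_spec n hn).1
  have h' : (partitionTable.getD (168 - n) 0 : ℝ) ≤ Fintype.card (Nat.Partition n) :=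
    mod_cast partitionTable_getD_le_card hn
  push_cast at h
  linarith

/-- The antiderivative of `fun x ↦ exp (2 * √x)` that vanishes at `0`. -/
noncomputable def expSqrtIntegral (x : ℝ) : ℝ := (√x - 1 / 2) * Real.exp (2 * √x) + 1 / 2

/-- The second antiderivative of `fun x ↦ exp (2 * √x)` that vanishes at `0`. -/
noncomputable def expSqrtIntegral₂ (x : ℝ) : ℝ :=
  (x - 3 / 2 * √x + 3 / 4) * Real.exp (2 * √x) - 3 / 4 + x / 2

theorem hasDerivAt_exp_two_mul_sqrt {x : ℝ} (hx : 0 < x) :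
    HasDerivAt (fun x => Real.exp (2 * √x)) (Real.exp (2 * √x) / √x) x := by
  have hs : √x ≠ 0 := (Real.sqrt_pos.2 hx).ne'
  refine ((Real.hasDerivAt_sqrt hx.ne').const_mul 2).exp.congr_deriv ?_
  field_simp

theorem hasDerivAt_expSqrtIntegral {x : ℝ} (hx : 0 < x) :
    HasDerivAt expSqrtIntegral (Real.exp (2 * √x)) x := by
  have hs : √x ≠ 0 := (Real.sqrt_pos.2 hx).ne'
  refine ((((Real.hasDerivAt_sqrt hx.ne').sub_const (1 / 2)).mul
    (hasDerivAt_exp_two_mul_sqrt hx)).add_const (1 / 2)).congr_deriv ?_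
  field_simp
  ring

theorem hasDerivAt_expSqrtIntegral₂ {x : ℝ} (hx : 0 < x) :
    HasDerivAt expSqrtIntegral₂ (expSqrtIntegral x) x := by
  have hs : √x ≠ 0 := (Real.sqrt_pos.2 hx).ne'
  have hsq : √x ^ 2 = x := Real.sq_sqrt hx.le
  refine ((((((hasDerivAt_id x).sub ((Real.hasDerivAt_sqrt hx.ne').const_mul (3 / 2))).add_const
    (3 / 4)).mul (hasDerivAt_exp_two_mul_sqrt hx)).sub_const (3 / 4)).add
    ((hasDerivAt_id x).div_const 2)).congr_deriv ?_
  simp only [expSqrtIntegral, id, Pi.sub_apply]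
  generalize √x = s at *
  subst hsq
  field_simp
  ring

theorem sub_le_mul_of_hasDerivAt_of_monotoneOn {f f' : ℝ → ℝ} (hf : ContinuousOn f (Set.Ici 0))
    (hf' : ∀ x, 0 < x → HasDerivAt f (f' x) x) (hmono : MonotoneOn f' (Set.Ici 0))
    {a b : ℝ} (ha : 0 ≤ a) (hab : a ≤ b) : f b - f a ≤ (b - a) * f' b := by
  rw [mul_comm]
  refine (convex_Icc a b).image_sub_le_mul_sub_of_deriv_le
    (hf.mono fun x hx => ha.trans hx.1) (fun x hx => ?_) (fun x hx => ?_)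
    a ⟨le_rfl, hab⟩ b ⟨hab, le_rfl⟩ hab
  all_goals
    rw [interior_Icc] at hx
    have hx0 : 0 < x := ha.trans_lt hx.1
  · exact (hf' x hx0).differentiableAt.differentiableWithinAt
  · rw [(hf' x hx0).deriv]
    exact hmono hx0.le (ha.trans hab) hx.2.le

theorem monotone_exp_two_mul_sqrt : Monotone fun x => Real.exp (2 * √x) := fun x y h => by
  have := Real.sqrt_le_sqrt h
  simpa using this

theorem continuous_expSqrtIntegral : Continuous expSqrtIntegral := by
  unfold expSqrtIntegral
  fun_prop

theorem continuous_expSqrtIntegral₂ : Continuous expSqrtIntegral₂ := by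
  unfold expSqrtIntegral₂
  fun_prop

theorem monotoneOn_expSqrtIntegral : MonotoneOn expSqrtIntegral (Set.Ici 0) := by
  refine monotoneOn_of_deriv_nonneg (convex_Ici 0) continuous_expSqrtIntegral.continuousOn
    (fun x hx => ?_) fun x hx => ?_
  all_goals
    rw [interior_Ici] at hx
    have h := hasDerivAt_expSqrtIntegral hx
  · exact h.differentiableAt.differentiableWithinAt
  · rw [h.deriv]
    positivity

theorem expSqrtIntegral_sub_le {a b : ℝ} (ha : 0 ≤ a) (hab : a ≤ b) :
    expSqrtIntegral b - expSqrtIntegral a ≤ (b - a) * Real.exp (2 * √b) :=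
  sub_le_mul_of_hasDerivAt_of_monotoneOn continuous_expSqrtIntegral.continuousOn
    (fun _ => hasDerivAt_expSqrtIntegral) (monotone_exp_two_mul_sqrt.monotoneOn _) ha hab

theorem expSqrtIntegral₂_sub_le {a b : ℝ} (ha : 0 ≤ a) (hab : a ≤ b) :
    expSqrtIntegral₂ b - expSqrtIntegral₂ a ≤ (b - a) * expSqrtIntegral b :=
  sub_le_mul_of_hasDerivAt_of_monotoneOn continuous_expSqrtIntegral₂.continuousOn
    (fun _ => hasDerivAt_expSqrtIntegral₂) monotoneOn_expSqrtIntegral ha hab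

theorem expSqrtIntegral_zero : expSqrtIntegral 0 = 0 := by
  simp [expSqrtIntegral]

theorem expSqrtIntegral₂_zero : expSqrtIntegral₂ 0 = 0 := by
  simp [expSqrtIntegral₂]

/-- Comparison of a left Riemann sum of mesh `l` with the integral. -/
theorem expSqrtIntegral_le_sum {l : ℕ} (hl : 0 < l) (n : ℕ) :
    expSqrtIntegral n ≤ l * ∑ i ∈ range (n / l + 1), Real.exp (2 * √(n - i * l : ℕ)) := by
  induction n using Nat.strong_induction_on with
  | _ n ih =>
    rcases lt_or_ge n l with h | h
    · have h1 := expSqrtIntegral_sub_le le_rfl (Nat.cast_nonneg (α := ℝ) n)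
      rw [expSqrtIntegral_zero, sub_zero, sub_zero] at h1
      simpa [Nat.div_eq_of_lt h] using
        h1.trans (mul_le_mul_of_nonneg_right (Nat.cast_le.2 h.le) (Real.exp_nonneg _))
    · obtain ⟨k, rfl⟩ := Nat.exists_eq_add_of_le' h
      have h1 := expSqrtIntegral_sub_le (Nat.cast_nonneg (α := ℝ) k)
        (Nat.cast_le (α := ℝ).2 (Nat.le_add_right k l))
      have h2 := ih k (by omega)
      rw [Nat.add_div_right k hl, Finset.sum_range_succ', mul_add]
      simp only [add_mul, one_mul, Nat.add_sub_add_right, zero_mul, Nat.sub_zero]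
      push_cast at h1 ⊢
      linarith

/-- Comparison of an iterated left Riemann sum of mesh `l` with the iterated integral. -/
theorem expSqrtIntegral₂_le_sum {l : ℕ} (hl : 0 < l) (n : ℕ) :
    expSqrtIntegral₂ n ≤
      l ^ 2 * ∑ i ∈ range (n / l + 1), (i + 1 : ℝ) * Real.exp (2 * √(n - i * l : ℕ)) := by
  induction n using Nat.strong_induction_on with
  | _ n ih =>
    have hl' : (0 : ℝ) < l := Nat.cast_pos.2 hl
    have h0 := expSqrtIntegral_le_sum hl n
    rcases lt_or_ge n l with h | h
    · have h1 := expSqrtIntegral₂_sub_le le_rfl (Nat.cast_nonneg (α := ℝ) n)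
      have h2 : 0 ≤ expSqrtIntegral n := by
        rw [← expSqrtIntegral_zero]
        exact monotoneOn_expSqrtIntegral Set.self_mem_Ici
          (Set.mem_Ici.2 (Nat.cast_nonneg n)) (Nat.cast_nonneg n)
      have h3 : (n : ℝ) ≤ l := Nat.cast_le.2 h.le
      rw [expSqrtIntegral₂_zero, sub_zero, sub_zero] at h1
      simp only [Nat.div_eq_of_lt h, zero_add, Finset.sum_range_one, zero_mul, Nat.sub_zero,
        Nat.cast_zero, one_mul] at h0 ⊢
      nlinarith
    · obtain ⟨k, rfl⟩ := Nat.exists_eq_add_of_le' h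
      have h1 := expSqrtIntegral₂_sub_le (Nat.cast_nonneg (α := ℝ) k)
        (Nat.cast_le (α := ℝ).2 (Nat.le_add_right k l))
      have h2 := ih k (by omega)
      simp only [add_mul (_ : ℝ) 1, Finset.sum_add_distrib, one_mul, mul_add]
      rw [Nat.add_div_right k hl, Finset.sum_range_succ']
      rw [Nat.add_div_right k hl] at h0
      simp only [Nat.succ_mul, Nat.add_sub_add_right, Nat.cast_zero, zero_mul, add_zero,
        Nat.cast_succ]
      push_cast at h0 h1 ⊢
      have h3 := mul_le_mul_of_nonneg_left h0 hl'.le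
      linarith

theorem expSqrtIntegral₂_sub_le_sum {n l : ℕ} (hl : 0 < l) (hn : l ≤ n) :
    expSqrtIntegral₂ n - l * expSqrtIntegral n ≤
      l ^ 2 * ∑ k ∈ Icc 1 n with l ∣ k, ((k / l : ℕ) : ℝ) * Real.exp (2 * √(n - k : ℕ)) := by
  have h1 := expSqrtIntegral₂_le_sum hl (n - l)
  have h2 := expSqrtIntegral₂_sub_le (Nat.cast_nonneg (α := ℝ) (n - l))
    (Nat.cast_le (α := ℝ).2 (Nat.sub_le n l))
  have h3 : ∑ i ∈ range ((n - l) / l + 1), (i + 1 : ℝ) * Real.exp (2 * √(n - l - i * l : ℕ)) ≤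
      ∑ k ∈ Icc 1 n with l ∣ k, ((k / l : ℕ) : ℝ) * Real.exp (2 * √(n - k : ℕ)) := by
    have hinj : Set.InjOn (fun i => (i + 1) * l) (range ((n - l) / l + 1)) := fun i _ j _ hij => by
      simpa [hl.ne'] using hij
    calc _ = ∑ k ∈ (range ((n - l) / l + 1)).image fun i => (i + 1) * l,
          ((k / l : ℕ) : ℝ) * Real.exp (2 * √(n - k : ℕ)) := by
          rw [Finset.sum_image hinj]
          refine Finset.sum_congr rfl fun i _ => ?_
          rw [Nat.mul_div_cancel _ hl, Nat.sub_sub, add_comm l, ← Nat.succ_mul, Nat.cast_succ]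
      _ ≤ _ := by
          refine Finset.sum_le_sum_of_subset_of_nonneg (fun k hk => ?_) fun k _ _ => by positivity
          obtain ⟨i, hi, rfl⟩ := Finset.mem_image.1 hk
          rw [Finset.mem_range, Nat.lt_succ_iff, Nat.le_div_iff_mul_le hl] at hi
          rw [Finset.mem_filter, Finset.mem_Icc, add_mul, one_mul]
          exact ⟨⟨by omega, by omega⟩, Dvd.intro_left (i + 1) (by ring)⟩
  rw [Nat.cast_sub hn] at h1 h2
  have h4 := mul_le_mul_of_nonneg_left h3 (sq_nonneg (l : ℝ))
  linarith

theorem add_ite_half_le_sum_divisors {k : ℕ} (hk : 0 < k) :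
    k + (if 2 ∣ k then k / 2 else 0) ≤ ∑ m ∈ k.divisors, m := by
  rw [← Nat.cons_self_properDivisors hk.ne', Finset.sum_cons]
  split_ifs with h
  · exact Nat.add_le_add_left (Finset.single_le_sum (f := fun m => m) (fun _ _ => Nat.zero_le _)
      (Nat.mem_properDivisors.2 ⟨Nat.div_dvd_of_dvd h, Nat.div_lt_self hk one_lt_two⟩)) _
  · exact Nat.le_add_right _ _

theorem mul_exp_lt_sum_divisors_mul_exp {n : ℕ} (hn : 169 ≤ n) :
    n * Real.exp (2 * √n) <
      ∑ k ∈ Icc 1 n, ((∑ m ∈ k.divisors, m : ℕ) : ℝ) * Real.exp (2 * √(n - k : ℕ)) := by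
  have h1 := expSqrtIntegral₂_sub_le_sum one_pos (n := n) (by omega)
  have h2 := expSqrtIntegral₂_sub_le_sum two_pos (n := n) (by omega)
  have h3 : ∑ k ∈ Icc 1 n with 1 ∣ k, ((k / 1 : ℕ) : ℝ) * Real.exp (2 * √(n - k : ℕ)) +
      ∑ k ∈ Icc 1 n with 2 ∣ k, ((k / 2 : ℕ) : ℝ) * Real.exp (2 * √(n - k : ℕ)) ≤
      ∑ k ∈ Icc 1 n, ((∑ m ∈ k.divisors, m : ℕ) : ℝ) * Real.exp (2 * √(n - k : ℕ)) := by
    rw [Finset.sum_filter, Finset.sum_filter, ← Finset.sum_add_distrib]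
    refine Finset.sum_le_sum fun k hk => ?_
    have h := Nat.cast_le (α := ℝ).2 (add_ite_half_le_sum_divisors (Finset.mem_Icc.1 hk).1)
    refine le_trans (le_of_eq ?_) (mul_le_mul_of_nonneg_right h (Real.exp_nonneg _))
    rw [if_pos (one_dvd k), Nat.div_one, Nat.cast_add, add_mul]
    split_ifs <;> simp
  have ht : (13 : ℝ) ≤ √n := Real.le_sqrt_of_sq_le (by norm_num; exact_mod_cast hn)
  have hsq : √(n : ℝ) ^ 2 = n := Real.sq_sqrt (Nat.cast_nonneg n)
  have he : 0 < Real.exp (2 * √n) := Real.exp_pos _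
  refine lt_of_lt_of_le ?_ h3
  simp only [expSqrtIntegral, expSqrtIntegral₂] at h1 h2
  push_cast at h1 h2
  have h4 : 0 < (√n ^ 2 - 27 / 2 * √n + 27 / 4) * Real.exp (2 * √n) :=
    mul_pos (by nlinarith) he
  rw [hsq] at h4
  have hn' : (169 : ℝ) ≤ n := by exact_mod_cast hn
  nlinarith

theorem exp_lt_card (n : ℕ) :
    Real.exp (2 * √n) < 14 * (Fintype.card (Nat.Partition n) : ℝ) := by
  induction n using Nat.strong_induction_on with
  | _ n ih =>
    rcases lt_or_ge n 169 with hn | hn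
    · exact exp_lt_card_of_lt hn
    have h0 : (0 : ℝ) < n := Nat.cast_pos.2 (by omega)
    refine lt_of_mul_lt_mul_left ((mul_exp_lt_sum_divisors_mul_exp hn).trans_le ?_) h0.le
    calc _ ≤ ∑ k ∈ Icc 1 n, ((∑ m ∈ k.divisors, m : ℕ) : ℝ) *
          (14 * (Fintype.card (Nat.Partition (n - k)) : ℝ)) := by
          refine Finset.sum_le_sum fun k hk => mul_le_mul_of_nonneg_left ?_ (Nat.cast_nonneg _)
          rw [Finset.mem_Icc] at hk
          exact (ih (n - k) (by omega)).le
      _ = 14 * ((∑ k ∈ Icc 1 n, (∑ m ∈ k.divisors, m) *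
          Fintype.card (Nat.Partition (n - k)) : ℕ) : ℝ) := by
          push_cast
          rw [Finset.mul_sum]
          exact Finset.sum_congr rfl fun k _ => by ring
      _ ≤ 14 * ((n * Fintype.card (Nat.Partition n) : ℕ) : ℝ) := by
          gcongr
          exact Nat.Partition.sum_divisors_mul_card_le n
      _ = _ := by push_cast; ring

theorem add_four_le_card {n : ℕ} (h : 6 ≤ n) :
    (n : ℝ) + 4 ≤ Fintype.card (Nat.Partition n) := by
  rcases lt_or_ge n 169 with hn | hn
  · exact_mod_cast ((partitionTable_spec n hn).2 h).trans (partitionTable_getD_le_card hn)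
  have h1 := exp_lt_card n
  have h2 := Real.quadratic_le_exp_of_nonneg (Real.sqrt_nonneg n)
  have h3 : (169 : ℝ) ≤ n := by exact_mod_cast hn
  rw [Real.sq_sqrt (Nat.cast_nonneg n)] at h2
  rw [two_mul, Real.exp_add] at h1
  have h4 : (n : ℝ) / 2 ≤ Real.exp √n := by linarith [Real.sqrt_nonneg n]
  nlinarith [mul_self_le_mul_self (by positivity) h4]

theorem Real.logb_two_natCast_le_half {n : ℕ} (h : 4 ≤ n) : Real.logb 2 n ≤ n / 2 := by
  have hpow : n ^ 2 ≤ 2 ^ n := by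
    induction n, h using Nat.le_induction with
    | base => norm_num
    | succ k hk ih =>
      rw [pow_succ 2 k]
      nlinarith
  have h1 : Real.logb 2 ((n : ℝ) ^ 2) ≤ Real.logb 2 ((2 : ℝ) ^ n) :=
    Real.logb_le_logb_of_le one_lt_two (by positivity) (by exact_mod_cast hpow)
  rw [Real.logb_pow, Real.logb_pow, Real.logb_self_eq_one one_lt_two] at h1
  push_cast at h1
  linarith

/-- For every integer `n ≥ 6`, the number of partitions `p(n)` satisfies
`p(n) > e^{2√n} / 14`, and consequently `p(n)/2 ≥ log₂ n + 2`. -/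
theorem stmt14 {n : ℕ} (h : 6 ≤ n) :
    Real.exp (2 * Real.sqrt n) / 14 < (Fintype.card (Nat.Partition n) : ℝ) ∧
    Real.logb 2 n + 2 ≤ (Fintype.card (Nat.Partition n) : ℝ) / 2 := by
  have h1 := exp_lt_card n
  have h2 := add_four_le_card h
  have h3 := Real.logb_two_natCast_le_half (show 4 ≤ n by omega)
  constructor <;> linarith
end
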